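/- arXiv:1104.4755 — 2 statements merged into one kernel-verified Lean document; each statement's English description precedes it below -/
import Mathlib

section
/- For each n ≥ 1, the T-space W_{n,X} is closed under multiplication, i.e., W_{n,X} is a non-unital subalgebra of k⟨X⟩₀: for all a, b ∈ W_{n,X}, a·b ∈ W_{n,X}. -/
variable (k : Type*) [Field k] [Fintype k] (X : Type*)

/-- `k⟨X⟩₀`: the free non-unital associative `k`-algebra on `X`, identified with
the augmentation submodule (elements with zero constant term) of the free
unital associative algebra `FreeAlgebra k X`. -/
noncomputable def AugF : Submodule k (FreeAlgebra k X) :=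
  LinearMap.ker (FreeAlgebra.lift k (fun _ : X => (0 : k))).toLinearMap

/-- A `T`-space of `k⟨X⟩₀`: a `k`-linear subspace of `k⟨X⟩₀` invariant under all
substitutions `x ↦ g x` with each `g x ∈ k⟨X⟩₀` (equivalently, under all
non-unital `k`-algebra endomorphisms of `k⟨X⟩₀`). -/
def IsTSpaceF (V : Submodule k (FreeAlgebra k X)) : Prop :=
  V ≤ AugF k X ∧
    ∀ g : X → FreeAlgebra k X, (∀ x, g x ∈ AugF k X) →
      ∀ v ∈ V, FreeAlgebra.lift k g v ∈ V

/-- `H^S`: the smallest `T`-space of `k⟨X⟩₀` containing `H`. -/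
noncomputable def TSpF (H : Set (FreeAlgebra k X)) : Submodule k (FreeAlgebra k X) :=
  sInf {V | IsTSpaceF k X V ∧ H ⊆ V}

/-- A `T`-ideal of `k⟨X⟩₀`: a `T`-space that is also a (two-sided) ideal of `k⟨X⟩₀`. -/
def IsTIdealF (V : Submodule k (FreeAlgebra k X)) : Prop :=
  IsTSpaceF k X V ∧ ∀ v ∈ V, ∀ a ∈ AugF k X, a * v ∈ V ∧ v * a ∈ V

/-- `H^T`: the smallest `T`-ideal of `k⟨X⟩₀` containing `H`. -/
noncomputable def TIdF (H : Set (FreeAlgebra k X)) : Submodule k (FreeAlgebra k X) :=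
  sInf {V | IsTIdealF k X V ∧ H ⊆ V}

/-- `W_{n,X} = {x + x^{q^n}}^S + {x^{q^n+1}}^S` for a fixed generator `x ∈ X`. -/
noncomputable def WnF (x : X) (n : ℕ) : Submodule k (FreeAlgebra k X) :=
  TSpF k X {FreeAlgebra.ι k x + FreeAlgebra.ι k x ^ (Fintype.card k ^ n)} ⊔
    TSpF k X {FreeAlgebra.ι k x ^ (Fintype.card k ^ n + 1)}

/-- `U_{n,X} = {x - x^{q^{2n}}}^T` for a fixed generator `x ∈ X`. -/
noncomputable def UnF (x : X) (n : ℕ) : Submodule k (FreeAlgebra k X) :=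
  TIdF k X {FreeAlgebra.ι k x - FreeAlgebra.ι k x ^ (Fintype.card k ^ (2 * n))}


namespace WnP

/-- The abstract setting. -/
structure Good {R V : Type*} [Ring R] [AddCommGroup V] (p j : ℕ) (S : AddSubgroup R)
    (L : R →+ V) : Prop where
  prime : p.Prime
  jpos : 1 ≤ j
  char : (p : R) = 0
  mulL : ∀ r s : R, s ∈ S → r * s ∈ S
  mulR : ∀ s r : R, s ∈ S → s * r ∈ S
  hQ : ∀ u ∈ S, L (u ^ p ^ j) = - L u
  hQ1 : ∀ u ∈ S, L (u ^ (p ^ j + 1)) = 0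
  nondeg : ∀ r ∈ S, (∀ x y : R, L (x * r * y) = 0) → r = 0

theorem add_pow_p {A : Type*} [Ring A] {p : ℕ} (hp : p.Prime) (hc : (p : A) = 0) {x y : A}
    (h : Commute x y) (n : ℕ) : (x + y) ^ p ^ n = x ^ p ^ n + y ^ p ^ n := by
  obtain ⟨r, hr⟩ := h.exists_add_pow_prime_pow_eq hp n
  rw [hr, hc]; simp

theorem neg_pow_p {A : Type*} [Ring A] {p : ℕ} (hp : p.Prime) (hc : (p : A) = 0) (x : A)
    (n : ℕ) : (-x) ^ p ^ n = -(x ^ p ^ n) := by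
  have := add_pow_p hp hc (show Commute x (-x) from (Commute.refl x).neg_right) n
  rw [add_neg_cancel, zero_pow (pow_ne_zero _ hp.ne_zero)] at this
  exact (neg_eq_of_add_eq_zero_right this.symm).symm

theorem sub_pow_p {A : Type*} [Ring A] {p : ℕ} (hp : p.Prime) (hc : (p : A) = 0) {x y : A}
    (h : Commute x y) (n : ℕ) : (x - y) ^ p ^ n = x ^ p ^ n - y ^ p ^ n := by
  rw [sub_eq_add_neg, add_pow_p hp hc h.neg_right, neg_pow_p hp hc, sub_eq_add_neg]

namespace Good

variable {R V : Type*} [Ring R] [AddCommGroup V] {p j : ℕ} {S : AddSubgroup R} {L : R →+ V}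

theorem pow_mem (g : Good p j S L) {u : R} (hu : u ∈ S) {n : ℕ} (hn : n ≠ 0) : u ^ n ∈ S := by
  obtain ⟨m, rfl⟩ := Nat.exists_eq_succ_of_ne_zero hn
  rw [pow_succ]; exact g.mulL _ _ hu

theorem Qne (g : Good p j S L) : p ^ j ≠ 0 := pow_ne_zero _ g.prime.ne_zero

theorem two_le_Q (g : Good p j S L) : 2 ≤ p ^ j :=
  g.prime.two_le.trans (Nat.le_self_pow (by have := g.jpos; omega) p)

theorem hN (g : Good p j S L) {u : R} (hu : u ∈ S) : L (u ^ p ^ (2 * j)) = L u := by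
  have : p ^ (2 * j) = p ^ j * p ^ j := by rw [two_mul, pow_add]
  rw [this, pow_mul, g.hQ _ (g.pow_mem hu g.Qne), g.hQ _ hu, neg_neg]

theorem hNr (g : Good p j S L) {u : R} (hu : u ∈ S) (r : ℕ) :
    L (u ^ p ^ (2 * j * r)) = L u := by
  induction r with
  | zero => simp
  | succ r ih =>
    rw [mul_add, pow_add, mul_one, pow_mul, g.hN (g.pow_mem hu (pow_ne_zero _ g.prime.ne_zero)), ih]

theorem le_pow (g : Good p j S L) (r : ℕ) : r ≤ p ^ (2 * j * r) := by
  have h1 : r ≤ 2 * j * r := by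
    have := g.jpos; nlinarith
  exact h1.trans (Nat.lt_pow_self g.prime.one_lt).le

theorem nil (g : Good p j S L) {u : R} (hu : u ∈ S) (hn : IsNilpotent u) : L u = 0 := by
  obtain ⟨r, hr⟩ := hn
  rw [← g.hNr hu r, pow_eq_zero_of_le (g.le_pow r) hr, map_zero]

theorem sqz (g : Good p j S L) {u : R} (hu : u ∈ S) (hn : u * u = 0) : L u = 0 :=
  g.nil hu ⟨2, by rw [pow_two, hn]⟩

theorem comm1 (g : Good p j S L) {a b : R} (ha : a ∈ S) (hb : b ∈ S) (h : Commute a b) :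
    L (a ^ p ^ j * b) = - L (a * b ^ p ^ j) := by
  have h1 := g.hQ1 _ (S.add_mem ha hb)
  rw [pow_succ, add_pow_p g.prime g.char h, add_mul, mul_add, mul_add, ← pow_succ, ← pow_succ,
    map_add, map_add, map_add, g.hQ1 _ ha, g.hQ1 _ hb, zero_add, add_zero,
    (h.pow_right (p ^ j)).eq.symm] at h1
  exact eq_neg_of_add_eq_zero_left h1

theorem comm (g : Good p j S L) {a b : R} (ha : a ∈ S) (hb : b ∈ S) (h : Commute a b) :
    L (a * b ^ p ^ (2 * j)) = L (a * b) := by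
  have : p ^ (2 * j) = p ^ j * p ^ j := by rw [two_mul, pow_add]
  rw [this, pow_mul]
  have h1 := g.comm1 ha (g.pow_mem hb g.Qne) (h.pow_right (p ^ j))
  rw [← (h).mul_pow, g.hQ _ (g.mulL _ _ hb)] at h1
  exact (neg_injective h1).symm

theorem eq_zero_of_nil (g : Good p j S L) {r : R} (hr : r ∈ S)
    (h : ∀ x, IsNilpotent (r * x)) : r = 0 := by
  refine g.nondeg r hr fun x y => g.nil (g.mulR _ _ (g.mulL _ _ hr)) ?_
  obtain ⟨n, hn⟩ := h (y * x)
  refine ⟨n + 1, ?_⟩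
  have : ∀ m, (x * r * y) ^ (m + 1) = x * (r * (y * x)) ^ m * r * y := by
    intro m
    induction m with
    | zero => simp
    | succ m ih => rw [pow_succ, ih, pow_succ]; noncomm_ring
  rw [this, hn]; simp

theorem eq_zero_of_S (g : Good p j S L) {r : R} (hr : r ∈ S)
    (h : ∀ x ∈ S, ∀ y ∈ S, x * r * y = 0) : r = 0 := by
  refine g.eq_zero_of_nil hr fun x => ⟨3, ?_⟩
  have := h (r * x) (g.mulR _ _ hr) (x * r * x) (g.mulR _ _ (g.mulL _ _ hr))
  calc (r * x) ^ 3 = r * x * r * (x * r * x) := by noncomm_ring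
    _ = 0 := this

theorem nondegS (g : Good p j S L) {r : R} (hr : r ∈ S)
    (h : ∀ x ∈ S, ∀ y ∈ S, L (x * r * y) = 0) : r = 0 := by
  refine g.eq_zero_of_S hr fun x hx y hy => ?_
  refine g.nondeg _ (g.mulL _ _ hy) fun a b => ?_
  have := h (a * x) (g.mulL _ _ hx) (y * b) (g.mulR _ _ hy)
  rw [← this]; noncomm_ring

end Good
end WnP


namespace WnP

section Sym
variable {A : Type*} [Ring A]

/-- polarisation of the `n`-th power -/
def Pol (a : ℕ → A) (n : ℕ) (s : Finset ℕ) : A :=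
  ∑ T ∈ s.powerset, (-1 : ℤ) ^ (s.card + T.card) • (∑ i ∈ T, a i) ^ n

/-- the symmetric multilinear polynomial -/
def Sy (a : ℕ → A) (s : Finset ℕ) : A := Pol a s.card s

theorem Pol_congr {a b : ℕ → A} {n : ℕ} {s : Finset ℕ} (h : ∀ i ∈ s, a i = b i) :
    Pol a n s = Pol b n s := by
  unfold Pol
  refine Finset.sum_congr rfl fun T hT => ?_
  rw [Finset.sum_congr rfl fun i hi => h i (Finset.mem_powerset.1 hT hi)]

theorem Sy_congr {a b : ℕ → A} {s : Finset ℕ} (h : ∀ i ∈ s, a i = b i) :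
    Sy a s = Sy b s := Pol_congr h

theorem Pol_op (a : ℕ → A) (n : ℕ) (s : Finset ℕ) :
    Pol (fun i => MulOpposite.op (a i)) n s = MulOpposite.op (Pol a n s) := by
  unfold Pol
  rw [Finset.op_sum]
  refine Finset.sum_congr rfl fun T hT => ?_
  rw [MulOpposite.op_smul, MulOpposite.op_pow, Finset.op_sum]

theorem Sy_op (a : ℕ → A) (s : Finset ℕ) :
    Sy (fun i => MulOpposite.op (a i)) s = MulOpposite.op (Sy a s) := Pol_op _ _ _

theorem Pol_split (f : Finset ℕ → A) (s : Finset ℕ) {i : ℕ} (hi : i ∈ s) :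
    ∑ T ∈ s.powerset with i ∈ T, (-1 : ℤ) ^ (s.card + T.card) • f T =
      ∑ T ∈ s.powerset, (-1 : ℤ) ^ (s.card + T.card) • f T +
      ∑ T ∈ (s.erase i).powerset, (-1 : ℤ) ^ ((s.erase i).card + T.card) • f T := by
  rw [← Finset.sum_filter_add_sum_filter_not s.powerset (fun T => i ∈ T)
    (fun T => (-1 : ℤ) ^ (s.card + T.card) • f T)]
  have : s.powerset.filter (fun T => ¬ i ∈ T) = (s.erase i).powerset := by
    ext T
    simp only [Finset.mem_filter, Finset.mem_powerset, Finset.subset_erase]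
  rw [this, add_assoc, ← Finset.sum_add_distrib]
  symm
  rw [add_eq_left]
  refine Finset.sum_eq_zero fun T _ => ?_
  rw [← Finset.card_erase_add_one hi, ← add_smul]
  convert zero_smul ℤ _
  ring

theorem Pol_succ (a : ℕ → A) (n : ℕ) (s : Finset ℕ) :
    Pol a (n + 1) s = ∑ i ∈ s, a i * (Pol a n s + Pol a n (s.erase i)) := by
  have h1 : ∀ i ∈ s, a i * (Pol a n s + Pol a n (s.erase i)) =
      ∑ T ∈ s.powerset, if i ∈ T then
        a i * ((-1 : ℤ) ^ (s.card + T.card) • (∑ l ∈ T, a l) ^ n) else 0 := by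
    intro i hi
    unfold Pol
    rw [← Pol_split (fun T => (∑ l ∈ T, a l) ^ n) s hi, Finset.mul_sum, Finset.sum_filter]
  rw [Finset.sum_congr rfl h1, Finset.sum_comm]
  unfold Pol
  refine Finset.sum_congr rfl fun T hT => ?_
  rw [← Finset.sum_filter, pow_succ', Finset.sum_mul, Finset.smul_sum]
  have : s.filter (fun i => i ∈ T) = T := by
    ext i
    have hT' : i ∈ T → i ∈ s := fun hi => Finset.mem_powerset.1 hT hi
    simp only [Finset.mem_filter]; tauto
  rw [this]
  exact Finset.sum_congr rfl fun i _ => (mul_smul_comm _ _ _).symm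

theorem Pol_zero_of_lt (a : ℕ → A) (n : ℕ) (s : Finset ℕ) (h : n < s.card) :
    Pol a n s = 0 := by
  induction n generalizing s with
  | zero =>
    unfold Pol
    have hs : s ≠ ∅ := by rintro rfl; simp at h
    have := Finset.sum_powerset_neg_one_pow_card (x := s)
    rw [if_neg hs] at this
    simp only [pow_zero, pow_add, mul_smul]
    rw [← Finset.smul_sum, ← Finset.sum_smul, this]; simp
  | succ n ih =>
    rw [Pol_succ]
    refine Finset.sum_eq_zero fun i hi => ?_
    rw [ih s (by omega), ih (s.erase i) (by rw [Finset.card_erase_of_mem hi]; omega)]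
    simp

theorem Sy_empty (a : ℕ → A) : Sy a ∅ = 1 := by
  simp [Sy, Pol]

theorem Sy_left (a : ℕ → A) (s : Finset ℕ) (hs : s.Nonempty) :
    Sy a s = ∑ i ∈ s, a i * Sy a (s.erase i) := by
  have hc := hs.card_pos
  obtain ⟨n, hn⟩ := Nat.exists_eq_succ_of_ne_zero hc.ne'
  unfold Sy
  rw [hn, Nat.succ_eq_add_one, Pol_succ]
  refine Finset.sum_congr rfl fun i hi => ?_
  rw [Pol_zero_of_lt a n s (by omega), Finset.card_erase_of_mem hi, hn]
  simp

theorem Sy_right (a : ℕ → A) (s : Finset ℕ) (hs : s.Nonempty) :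
    Sy a s = ∑ i ∈ s, Sy a (s.erase i) * a i := by
  have := Sy_left (fun i => MulOpposite.op (a i)) s hs
  simp only [Sy_op, ← MulOpposite.op_mul, ← Finset.op_sum] at this
  exact MulOpposite.op_injective this

theorem Sy_ins (a : ℕ → A) (o : ℕ) (s : Finset ℕ) (ho : o ∉ s) :
    ∑ i ∈ s, Sy (Function.update a i (a i * a o)) s = Sy a (insert o s) - a o * Sy a s := by
  induction hn : s.card generalizing s with
  | zero =>
    have : s = ∅ := Finset.card_eq_zero.1 hn
    subst this
    rw [Sy_left a (insert o ∅) (by simp)]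
    simp [Sy_empty]
  | succ n ih =>
    have hs : s.Nonempty := Finset.card_pos.1 (by omega)
    rw [Sy_left a (insert o s) (by simp), Finset.sum_insert ho, Finset.erase_insert ho,
      add_sub_cancel_left]
    have h1 : ∀ i ∈ s, Sy (Function.update a i (a i * a o)) s =
        a i * a o * Sy a (s.erase i) +
          ∑ l ∈ s.erase i, a l * Sy (Function.update a i (a i * a o)) (s.erase l) := by
      intro i hi
      rw [Sy_left _ s hs, ← Finset.add_sum_erase _ _ hi]
      congr 1
      · rw [Function.update_self]
        congr 1
        exact Sy_congr fun l hl => Function.update_of_ne (Finset.ne_of_mem_erase hl) _ _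
      · refine Finset.sum_congr rfl fun l hl => ?_
        rw [Function.update_of_ne (Finset.ne_of_mem_erase hl)]
    rw [Finset.sum_congr rfl h1, Finset.sum_add_distrib]
    have h2 : ∑ i ∈ s, ∑ l ∈ s.erase i, a l * Sy (Function.update a i (a i * a o)) (s.erase l)
        = ∑ l ∈ s, a l * ∑ i ∈ s.erase l, Sy (Function.update a i (a i * a o)) (s.erase l) := by
      simp_rw [Finset.mul_sum]
      refine Finset.sum_comm' fun i l => ?_
      simp only [Finset.mem_erase]; grind
    rw [h2, ← Finset.sum_add_distrib]
    refine Finset.sum_congr rfl fun l hl => ?_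
    rw [ih (s.erase l) (by simp [ho]) (by rw [Finset.card_erase_of_mem hl]; omega),
      Finset.erase_insert_of_ne (by rintro rfl; exact ho hl)]
    noncomm_ring

theorem Sy_ins' (a : ℕ → A) (o : ℕ) (s : Finset ℕ) (ho : o ∉ s) :
    ∑ i ∈ s, Sy (Function.update a i (a o * a i)) s = Sy a (insert o s) - Sy a s * a o := by
  have := Sy_ins (fun i => MulOpposite.op (a i)) o s ho
  have h : ∀ i, Function.update (fun i => MulOpposite.op (a i)) i
      (MulOpposite.op (a i) * MulOpposite.op (a o)) =
      fun l => MulOpposite.op (Function.update a i (a o * a i) l) := by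
    intro i; ext l
    by_cases hl : l = i
    · subst hl; simp
    · simp [hl]
  simp only [h] at this
  simp only [Sy_op, ← MulOpposite.op_mul, ← Finset.op_sum, ← MulOpposite.op_sub] at this
  exact MulOpposite.op_injective this

theorem Sy_mem (I : AddSubgroup A) (hI : ∀ r s : A, s ∈ I → s * r ∈ I) (a : ℕ → A)
    (s : Finset ℕ) (hs : s.Nonempty) (ha : ∀ i ∈ s, a i ∈ I) : Sy a s ∈ I := by
  rw [Sy_left a s hs]
  exact sum_mem fun i hi => hI _ _ (ha i hi)

end Sym

namespace Good
variable {R V : Type*} [Ring R] [AddCommGroup V] {p j : ℕ} {S : AddSubgroup R} {L : R →+ V}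

theorem L_Sy (g : Good p j S L) (a : ℕ → R) (s : Finset ℕ) (hs : s.card = p ^ j)
    (ha : ∀ i ∈ s, a i ∈ S) : L (Sy a s) = 0 := by
  have h1 : L (Sy a s) = - L (Pol a 1 s) := by
    unfold Sy Pol
    rw [map_sum, map_sum, ← Finset.sum_neg_distrib]
    refine Finset.sum_congr rfl fun T hT => ?_
    rw [map_zsmul, map_zsmul, pow_one, hs,
      g.hQ _ (sum_mem fun i hi => ha i (Finset.mem_powerset.1 hT hi)), smul_neg]
  rw [h1, Pol_zero_of_lt _ _ _ (by rw [hs]; exact g.two_le_Q), map_zero, neg_zero]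

theorem L_Sy1 (g : Good p j S L) (a : ℕ → R) (s : Finset ℕ) (hs : s.card = p ^ j + 1)
    (ha : ∀ i ∈ s, a i ∈ S) : L (Sy a s) = 0 := by
  unfold Sy Pol
  rw [map_sum]
  refine Finset.sum_eq_zero fun T hT => ?_
  rw [map_zsmul, hs, g.hQ1 _ (sum_mem fun i hi => ha i (Finset.mem_powerset.1 hT hi)), smul_zero]

theorem upd_mem {a : ℕ → R} {s : Finset ℕ} (ha : ∀ i ∈ s, a i ∈ S) (o : ℕ) {x : R} (hx : x ∈ S) :
    ∀ i ∈ insert o s, Function.update a o x i ∈ S := by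
  intro i hi
  by_cases h : i = o
  · subst h; simpa
  · rw [Function.update_of_ne h]; exact ha i ((Finset.mem_insert.1 hi).resolve_left h)

theorem L_mul_Sy (g : Good p j S L) (a : ℕ → R) (s : Finset ℕ) (hs : s.card = p ^ j)
    (ha : ∀ i ∈ s, a i ∈ S) (x : R) (hx : x ∈ S) : L (x * Sy a s) = 0 := by
  obtain ⟨o, ho⟩ := Infinite.exists_notMem_finset s
  set b := Function.update a o x with hb
  have hbm := upd_mem ha o hx
  have hab : Sy a s = Sy b s := Sy_congr fun i hi =>
    (Function.update_of_ne (by rintro rfl; exact ho hi) _ _).symm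
  have hbo : b o = x := Function.update_self ..
  have h := congrArg L (Sy_ins b o s ho)
  rw [map_sub, g.L_Sy1 _ _ (by rw [Finset.card_insert_of_notMem ho, hs]) hbm, map_sum,
    Finset.sum_eq_zero, zero_sub, eq_comm, neg_eq_zero, hbo, ← hab] at h
  · exact h
  · intro i hi
    refine g.L_Sy _ _ hs fun l hl => ?_
    refine upd_mem (s := s) (fun i hi => hbm i (Finset.mem_insert_of_mem hi)) i ?_ l
      (Finset.mem_insert_of_mem hl)
    exact g.mulR _ _ (hbm i (Finset.mem_insert_of_mem hi))

theorem L_mul_Sy1 (g : Good p j S L) (a : ℕ → R) (o : ℕ) (s : Finset ℕ) (ho : o ∉ s)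
    (hs : s.card = p ^ j)
    (ha : ∀ i ∈ insert o s, a i ∈ S) (x : R) (hx : x ∈ S) : L (x * Sy a (insert o s)) = 0 := by
  have h := Sy_ins a o s ho
  have ha' : ∀ i ∈ s, a i ∈ S := fun i hi => ha i (Finset.mem_insert_of_mem hi)
  rw [eq_sub_iff_add_eq] at h
  rw [← h, mul_add, map_add, Finset.mul_sum, map_sum, ← mul_assoc,
    g.L_mul_Sy a s hs ha' _ (g.mulR _ _ hx), add_zero]
  refine Finset.sum_eq_zero fun i hi => ?_
  refine g.L_mul_Sy _ _ hs (fun l hl => ?_) x hx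
  exact upd_mem ha' i (g.mulR _ _ (ha' i hi)) l (Finset.mem_insert_of_mem hl)

theorem L_mul_Sy_mul (g : Good p j S L) (a : ℕ → R) (s : Finset ℕ) (hs : s.card = p ^ j)
    (ha : ∀ i ∈ s, a i ∈ S) (x : R) (hx : x ∈ S) (y : R) (hy : y ∈ S) :
    L (x * Sy a s * y) = 0 := by
  obtain ⟨o, ho⟩ := Infinite.exists_notMem_finset s
  set b := Function.update a o y with hb
  have hbm := upd_mem ha o hy
  have hbm' : ∀ i ∈ s, b i ∈ S := fun i hi => hbm i (Finset.mem_insert_of_mem hi)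
  have hab : Sy a s = Sy b s := Sy_congr fun i hi =>
    (Function.update_of_ne (by rintro rfl; exact ho hi) _ _).symm
  have hbo : b o = y := Function.update_self ..
  have h := congrArg (fun z => L (x * z)) (Sy_ins' b o s ho)
  rw [mul_sub, map_sub, g.L_mul_Sy1 _ _ _ ho hs hbm x hx, Finset.mul_sum, map_sum,
    Finset.sum_eq_zero, zero_sub, eq_comm, neg_eq_zero, hbo, ← hab, ← mul_assoc] at h
  · exact h
  · intro i hi
    refine g.L_mul_Sy _ _ hs (fun l hl => ?_) x hx
    exact upd_mem hbm' i (g.mulL _ _ (hbm' i hi)) l (Finset.mem_insert_of_mem hl)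

theorem Sy_eq_zero (g : Good p j S L) (a : ℕ → R) (s : Finset ℕ) (hs : s.card = p ^ j)
    (ha : ∀ i ∈ s, a i ∈ S) : Sy a s = 0 := by
  have hne : s.Nonempty := Finset.card_pos.1 (by rw [hs]; exact Nat.pos_of_ne_zero g.Qne)
  refine g.nondegS (Sy_mem S (fun r s h => g.mulR _ _ h) a s hne ha) fun x hx y hy => ?_
  exact g.L_mul_Sy_mul a s hs ha x hx y hy

end Good
end WnP


namespace WnP

section Tw
variable {A : Type*} [Ring A]

/-- multiply the entries in `J` by `θ` on the left -/
def tw (θ : A) (a : ℕ → A) (J : Finset ℕ) (i : ℕ) : A := if i ∈ J then θ * a i else a i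

/-- left side of the twisted identity -/
def twF (θ b : A) (a : ℕ → A) (o : ℕ) (s : Finset ℕ) (e : ℕ) : A :=
  ∑ J ∈ s.powerset, (-1 : ℤ) ^ J.card •
    Sy (Function.update (tw θ a J) o (b * θ ^ (e + (s \ J).card))) (insert o s)

/-- right side of the twisted identity -/
def twG (θ b : A) (a : ℕ → A) (s : Finset ℕ) (e : ℕ) : A :=
  ∑ J ∈ s.powerset, (-1 : ℤ) ^ J.card • (Sy (tw θ a J) s * (b * θ ^ (e + (s \ J).card)))

theorem twG_succ (θ b : A) (a : ℕ → A) (s : Finset ℕ) (e : ℕ) :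
    twG θ b a s (e + 1) = twG θ b a s e * θ := by
  unfold twG
  rw [Finset.sum_mul]
  refine Finset.sum_congr rfl fun J _ => ?_
  rw [smul_mul_assoc]
  congr 1
  rw [show e + 1 + (s \ J).card = (e + (s \ J).card) + 1 by ring, pow_succ]
  noncomm_ring

theorem twF_rec (θ b : A) (a : ℕ → A) (o : ℕ) (s : Finset ℕ) (ho : o ∉ s) (e : ℕ) :
    twF θ b a o s e = twG θ b a s e +
      ∑ i ∈ s, (twF θ b a o (s.erase i) (e + 1) * a i -
        twF θ b a o (s.erase i) e * (θ * a i)) := by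
  have h1 : ∀ J ∈ s.powerset, (-1 : ℤ) ^ J.card •
      Sy (Function.update (tw θ a J) o (b * θ ^ (e + (s \ J).card))) (insert o s) =
      (-1 : ℤ) ^ J.card • (Sy (tw θ a J) s * (b * θ ^ (e + (s \ J).card))) +
      ∑ i ∈ s, (-1 : ℤ) ^ J.card •
        (Sy (Function.update (tw θ a J) o (b * θ ^ (e + (s \ J).card))) (insert o (s.erase i))
          * tw θ a J i) := by
    intro J hJ
    rw [Sy_right _ (insert o s) (by simp), Finset.sum_insert ho, Finset.erase_insert ho,
      Function.update_self, smul_add, ← Finset.smul_sum]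
    congr 1
    · congr 2
      exact Sy_congr fun i hi => Function.update_of_ne (by rintro rfl; exact ho hi) _ _
    · congr 1
      refine Finset.sum_congr rfl fun i hi => ?_
      have hio : i ≠ o := by rintro rfl; exact ho hi
      rw [Function.update_of_ne hio, Finset.erase_insert_of_ne hio.symm]
  unfold twF
  rw [Finset.sum_congr rfl h1, Finset.sum_add_distrib, Finset.sum_comm]
  unfold twG
  congr 1
  refine Finset.sum_congr rfl fun i hi => ?_
  have his : insert i (s.erase i) = s := Finset.insert_erase hi
  have hpow : s.powerset = (insert i (s.erase i)).powerset := by rw [his]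
  rw [hpow, Finset.sum_powerset_insert (Finset.notMem_erase i s), sub_eq_add_neg]
  congr 1
  · rw [Finset.sum_mul]
    refine Finset.sum_congr rfl fun J hJ => ?_
    have hJ' := Finset.mem_powerset.1 hJ
    have hiJ : i ∉ J := fun h => Finset.notMem_erase i s (hJ' h)
    have hc : (s \ J).card = ((s.erase i) \ J).card + 1 := by
      have : (s.erase i) \ J = (s \ J).erase i := by
        ext l; simp only [Finset.mem_sdiff, Finset.mem_erase]; tauto
      rw [this, Finset.card_erase_add_one (by simp [hi, hiJ])]
    rw [smul_mul_assoc, hc, show tw θ a J i = a i by simp [tw, hiJ],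
      show e + (((s.erase i) \ J).card + 1) = e + 1 + ((s.erase i) \ J).card by ring]
  · rw [Finset.sum_mul, ← Finset.sum_neg_distrib]
    refine Finset.sum_congr rfl fun J hJ => ?_
    have hJ' := Finset.mem_powerset.1 hJ
    have hiJ : i ∉ J := fun h => Finset.notMem_erase i s (hJ' h)
    have hc : (s \ insert i J) = (s.erase i) \ J := by
      ext l; simp only [Finset.mem_sdiff, Finset.mem_erase, Finset.mem_insert]; tauto
    rw [hc, Finset.card_insert_of_notMem hiJ, pow_succ, mul_neg_one, neg_smul, smul_mul_assoc,
      show tw θ a (insert i J) i = θ * a i by simp [tw]]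
    congr 3
    refine Sy_congr fun l hl => ?_
    by_cases hlo : l = o
    · subst hlo; simp
    · rw [Function.update_of_ne hlo, Function.update_of_ne hlo]
      have : l ≠ i := by
        rintro rfl
        rcases Finset.mem_insert.1 hl with h | h
        · exact hlo h
        · exact Finset.notMem_erase _ _ h
      simp [tw, this]

theorem twF_eq (θ b : A) (a : ℕ → A) (o : ℕ) (s : Finset ℕ) (ho : o ∉ s) (e : ℕ) :
    twF θ b a o s e = twG θ b a s e := by
  induction hn : s.card generalizing s e with
  | zero =>
    have : s = ∅ := Finset.card_eq_zero.1 hn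
    subst this
    rw [twF_rec _ _ _ _ _ ho]; simp
  | succ n ih =>
    rw [twF_rec _ _ _ _ _ ho, Finset.sum_eq_zero, add_zero]
    intro i hi
    have hc : (s.erase i).card = n := by rw [Finset.card_erase_of_mem hi]; omega
    rw [ih _ (by simp [ho]) _ hc, ih _ (by simp [ho]) _ hc, twG_succ, mul_assoc, sub_self]

end Tw

/-- annihilating families -/
def Ann {R : Type*} [Ring R] (I : AddSubgroup R) (θ : R) (d : ℕ) (U : ℕ → R) : Prop :=
  (∀ e, U e ∈ I) ∧ ∀ b ∈ I, ∑ e ∈ Finset.range (d + 1), U e * b * θ ^ e = 0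

section AnnS
variable {R : Type*} [Ring R] {I : AddSubgroup R} {θ : R} {d : ℕ}

theorem exists_Ann (hl : ∀ r s : R, s ∈ I → r * s ∈ I) (hr : ∀ s r : R, s ∈ I → s * r ∈ I)
    (hI : I ≠ ⊥) (Q : ℕ) (hQ : ∀ (a : ℕ → R) (s : Finset ℕ), s.card = Q → (∀ i ∈ s, a i ∈ I) →
      Sy a s = 0) (θ : R) : ∃ d < Q, ∃ U, Ann I θ d U ∧ U d ≠ 0 := by
  classical
  have hex : ∃ m, ∀ (a : ℕ → R) (s : Finset ℕ), s.card = m → (∀ i ∈ s, a i ∈ I) →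
      Sy a s = 0 := ⟨Q, hQ⟩
  set m := Nat.find hex with hm
  have hspec := Nat.find_spec hex
  have hmQ : m ≤ Q := Nat.find_min' hex hQ
  obtain ⟨z, hzI, hz⟩ : ∃ z ∈ I, z ≠ 0 := by
    obtain ⟨z, hz⟩ := AddSubgroup.ne_bot_iff_exists_ne_zero.1 hI
    exact ⟨z.1, z.2, fun h => hz (Subtype.ext h)⟩
  have hS1 : Sy (fun _ => z) {0} = z := by
    rw [Sy_left _ _ (by simp)]; simp [Sy_empty]
  have hm0 : m ≠ 0 := by
    intro h0
    have := hspec (fun _ => z) ∅ (by rw [← hm, h0]; rfl) (by simp)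
    rw [Sy_empty] at this
    exact hz (by rw [← one_mul z, this, zero_mul])
  have hm1 : m ≠ 1 := by
    intro h0
    have := hspec (fun _ => z) {0} (by rw [← hm, h0]; rfl) (by simpa using hzI)
    exact hz (hS1.symm.trans this)
  have hlt := Nat.find_min hex (m := m - 1) (by omega)
  push Not at hlt
  obtain ⟨a, s, hs, ha, hne⟩ := hlt
  obtain ⟨o, ho⟩ := Infinite.exists_notMem_finset s
  have hsne : s.Nonempty := Finset.card_pos.1 (by omega)
  refine ⟨m - 1, by omega, fun e => ∑ J ∈ s.powerset with (s \ J).card = e,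
    (-1 : ℤ) ^ J.card • Sy (tw θ a J) s, ⟨?_, ?_⟩, ?_⟩
  · intro e
    refine sum_mem fun J _ => I.zsmul_mem ?_ _
    refine Sy_mem I (fun r s h => hr _ _ h) _ _ hsne fun i hi => ?_
    unfold tw
    split_ifs
    · exact hl _ _ (ha i hi)
    · exact ha i hi
  · intro b hb
    have h1 := twF_eq θ b a o s ho 0
    have h2 : twF θ b a o s 0 = 0 := by
      unfold twF
      refine Finset.sum_eq_zero fun J _ => ?_
      rw [hspec _ (insert o s) (by rw [Finset.card_insert_of_notMem ho]; omega), smul_zero]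
      intro i hi
      by_cases hio : i = o
      · subst hio; rw [Function.update_self]; exact hr _ _ hb
      · rw [Function.update_of_ne hio]
        have hi' := (Finset.mem_insert.1 hi).resolve_left hio
        unfold tw
        split_ifs
        · exact hl _ _ (ha i hi')
        · exact ha i hi'
    rw [h2] at h1
    rw [h1]
    unfold twG
    rw [← Finset.sum_fiberwise_of_maps_to (g := fun J => (s \ J).card)
      (t := Finset.range (m - 1 + 1))]
    · refine Finset.sum_congr rfl fun e _ => ?_
      rw [Finset.sum_mul, Finset.sum_mul]
      refine Finset.sum_congr rfl fun J hJ => ?_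
      rw [(Finset.mem_filter.1 hJ).2, zero_add, smul_mul_assoc, smul_mul_assoc, mul_assoc]
    · intro J hJ
      have := Finset.card_le_card (Finset.sdiff_subset (s := s) (t := J))
      simp only [Finset.mem_range]; omega
  · have : s.powerset.filter (fun J => (s \ J).card = m - 1) = {∅} := by
      ext J
      simp only [Finset.mem_filter, Finset.mem_powerset, Finset.mem_singleton]
      constructor
      · rintro ⟨h1, h2⟩
        have := Finset.card_sdiff_add_card_eq_card h1
        exact Finset.card_eq_zero.1 (by omega)
      · rintro rfl
        simp [hs]
    simp only [this, Finset.sum_singleton, Finset.card_empty, pow_zero, one_smul]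
    have h3 : tw θ a ∅ = a := by ext i; simp [tw]
    rw [h3]; exact hne

theorem Ann.left (hl : ∀ r s : R, s ∈ I → r * s ∈ I) {U : ℕ → R} (h : Ann I θ d U) (r : R) :
    Ann I θ d (fun e => r * U e) := by
  refine ⟨fun e => hl _ _ (h.1 e), fun b hb => ?_⟩
  have := h.2 b hb
  simp only [mul_assoc] at this ⊢
  rw [← Finset.mul_sum, this, mul_zero]

theorem Ann.right (hl : ∀ r s : R, s ∈ I → r * s ∈ I) (hr : ∀ s r : R, s ∈ I → s * r ∈ I)
    {U : ℕ → R} (h : Ann I θ d U) (r : R) :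
    Ann I θ d (fun e => U e * r) := by
  refine ⟨fun e => hr _ _ (h.1 e), fun b hb => ?_⟩
  have := h.2 (r * b) (hl _ _ hb)
  simpa only [mul_assoc] using this

theorem Ann.sub {U U' : ℕ → R} (h : Ann I θ d U) (h' : Ann I θ d U') :
    Ann I θ d (fun e => U e - U' e) := by
  refine ⟨fun e => I.sub_mem (h.1 e) (h'.1 e), fun b hb => ?_⟩
  simp only [sub_mul, Finset.sum_sub_distrib, h.2 b hb, h'.2 b hb, sub_self]

theorem Ann.eq_zero (hmin : ∀ e < d, ∀ U, Ann I θ e U → U e = 0) {U : ℕ → R} (h : Ann I θ d U)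
    (hd : U d = 0) : ∀ e ≤ d, U e = 0 := by
  by_contra hcon
  push Not at hcon
  obtain ⟨e0, he0, hne0⟩ := hcon
  classical
  have hne : ((Finset.range (d + 1)).filter fun e => U e ≠ 0).Nonempty :=
    ⟨e0, by simp; exact ⟨by omega, hne0⟩⟩
  set e := Finset.max' _ hne with he
  have hemem := Finset.max'_mem _ hne
  rw [← he, Finset.mem_filter, Finset.mem_range] at hemem
  have hed : e < d := by
    rcases lt_or_eq_of_le (Nat.lt_succ_iff.1 hemem.1) with h | h
    · exact h
    · exact absurd (h ▸ hd) hemem.2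
  refine hemem.2 (hmin e hed U ⟨h.1, fun b hb => ?_⟩)
  rw [← h.2 b hb]
  refine Finset.sum_subset (Finset.range_mono (by omega)) fun l hl hl' => ?_
  have : U l = 0 := by
    by_contra hh
    have := Finset.le_max' ((Finset.range (d + 1)).filter fun e => U e ≠ 0) l
      (Finset.mem_filter.2 ⟨hl, hh⟩)
    rw [← he] at this
    simp only [Finset.mem_range] at hl'
    omega
  rw [this, zero_mul, zero_mul]

theorem Ann.swap (hl : ∀ r s : R, s ∈ I → r * s ∈ I) (hr : ∀ s r : R, s ∈ I → s * r ∈ I)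
    (hmin : ∀ e < d, ∀ U, Ann I θ e U → U e = 0) {U : ℕ → R} (h : Ann I θ d U)
    (r : R) {i l : ℕ} (hi : i ≤ d) (hld : l ≤ d) : U i * r * U l = U l * r * U i := by
  have h0 : ∀ e ≤ d, U e * (r * U d) = U d * r * U e := by
    intro e he
    have := Ann.eq_zero hmin (((h.right hl hr (r * U d)).sub (h.left hl (U d * r))))
      (by simp [mul_assoc]) e he
    exact sub_eq_zero.1 this
  have h1 := Ann.eq_zero hmin (((h.right hl hr (r * U l)).sub (h.left hl (U l * r))))
      (by
        have := h0 l hld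
        simp only [mul_assoc] at this ⊢
        rw [this, sub_self]) i hi
  simpa only [mul_assoc] using sub_eq_zero.1 h1

end AnnS
end WnP


namespace WnP

namespace Good
variable {R V : Type*} [Ring R] [AddCommGroup V] {p j : ℕ} {S : AddSubgroup R} {L : R →+ V}

theorem two_le_N (g : Good p j S L) : 2 ≤ p ^ (2 * j) :=
  g.prime.two_le.trans (Nat.le_self_pow (by have := g.jpos; omega) p)

theorem chain (g : Good p j S L) (w : ℕ → R) (hw : ∀ i, w i ∈ S) (K : ℕ)
    (hK : K = p ^ (2 * j) * p ^ (2 * j))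
    (h : ∀ i < K, ∀ l < K, w (i + 1) * w l = w i * w (l + 1)) :
    L (w (p ^ (2 * j))) = L (w 1) := by
  have hN2 := g.two_le_N
  have hcomm := fun {a b : R} (ha : a ∈ S) (hb : b ∈ S) (hab : Commute a b) =>
    g.comm ha hb hab
  have hNL := fun {u : R} (hu : u ∈ S) => g.hN hu
  have hpm := fun {u : R} (hu : u ∈ S) {n : ℕ} (hn : n ≠ 0) => g.pow_mem hu hn
  generalize p ^ (2 * j) = N at *
  have hshift : ∀ t i l, i + t ≤ K → l + t ≤ K → w (i + t) * w l = w i * w (l + t) := by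
    intro t
    induction t with
    | zero => intro i l _ _; rfl
    | succ t ih =>
      intro i l h1 h2
      rw [← add_assoc, h _ (by omega) _ (by omega), ih _ _ (by omega) (by omega)]
      congr 2; omega
  have hc' : ∀ i t, i + t ≤ K → Commute (w (i + t)) (w i) := fun i t hi => hshift t i i hi hi
  have hc : ∀ i l, i ≤ K → l ≤ K → Commute (w i) (w l) := by
    intro i l hi hl
    rcases le_total i l with hh | hh
    · obtain ⟨t, rfl⟩ := Nat.exists_eq_add_of_le hh
      exact (hc' i t hl).symm
    · obtain ⟨t, rfl⟩ := Nat.exists_eq_add_of_le hh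
      exact hc' l t hi
  have hpow : ∀ t m, t * (m + 1) ≤ K → w t ^ (m + 1) = w (t * (m + 1)) * w 0 ^ m := by
    intro t m
    induction m with
    | zero => intro _; simp
    | succ m ih =>
      intro hm
      have h1 : t * (m + 1 + 1) = t + t * (m + 1) := by ring
      have h2 : t * (m + 1) ≤ K := by omega
      have h3 : t ≤ K := by omega
      rw [pow_succ, ih h2, mul_assoc, ((hc 0 t (by omega) h3).pow_left m).eq, ← mul_assoc]
      have := hshift (t * (m + 1)) 0 t (by omega) (by omega)
      rw [zero_add] at this
      rw [this, (hc 0 _ (by omega) (by omega)).eq, h1, pow_succ', ← mul_assoc]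
  obtain ⟨n, rfl⟩ : ∃ n, N = n + 2 := ⟨N - 2, by omega⟩
  set N := n + 2 with hN
  have hNK : N ≤ K := by nlinarith
  have e1 : w N ^ N = w K * w 0 ^ (n + 1) := by
    have := hpow N (n + 1) (by rw [hK])
    rw [← hK] at this; exact this
  have e2 : w 1 ^ N = w N * w 0 ^ (n + 1) := by
    have := hpow 1 (n + 1) (by omega)
    rw [one_mul] at this; exact this
  have c0N := (hc 0 N (by omega) hNK)
  have c0K := (hc 0 K (by omega) le_rfl)
  rw [← hNL (hw N), e1, pow_succ, ← mul_assoc, ← hNL (hw 1), e2]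
  calc L (w K * w 0 ^ n * w 0) = L (w K * w 0 ^ n * w 0 ^ N) :=
        (hcomm (g.mulR _ _ (hw K)) (hw 0) (c0K.symm.mul_left ((Commute.refl _).pow_left n))).symm
    _ = L (w 0 ^ (n + 1) * w N ^ N) := by
        rw [e1, ← mul_assoc, (c0K.pow_left (n + 1)).eq, mul_assoc, mul_assoc, ← pow_add,
          ← pow_add, hN]
        congr 3; ring
    _ = L (w 0 ^ (n + 1) * w N) :=
        hcomm (hpm (hw 0) (by omega)) (hw N) (c0N.pow_left _)
    _ = L (w N * w 0 ^ (n + 1)) := by rw [(c0N.pow_left (n + 1)).eq]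

theorem chain2 (g : Good p j S L) (u v : R) (hu : u ∈ S) (hv : v ∈ S)
    (h : ∀ r, u * r * v = v * r * u) (K : ℕ) (hK : K = p ^ (2 * j) * p ^ (2 * j)) :
    v ^ p ^ (2 * j) * u ^ (K - p ^ (2 * j)) = v * u ^ (K - 1) := by
  have hN2 := g.two_le_N
  have hK0 : K ≠ 0 := by rw [hK]; positivity
  have huv : Commute u v := by
    have := h 1
    rwa [mul_one, mul_one] at this
  have hmem : ∀ i, v ^ i * u ^ (K - i) ∈ S := by
    intro i
    rcases Nat.eq_zero_or_pos i with hi | hi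
    · subst hi; simpa using g.pow_mem hu hK0
    · exact g.mulR _ _ (g.pow_mem hv hi.ne')
  refine sub_eq_zero.1 (g.nondeg _ (S.sub_mem (hmem _) (by simpa using hmem 1)) fun x y => ?_)
  rw [mul_sub, sub_mul, map_sub, sub_eq_zero]
  have := g.chain (fun i => x * (v ^ i * u ^ (K - i)) * y)
    (fun i => g.mulR _ _ (g.mulL _ _ (hmem i))) K hK ?_
  · simpa using this
  · intro i hi l hl
    obtain ⟨a, rfl⟩ : ∃ a, K = i + 1 + a := ⟨K - i - 1, by omega⟩
    obtain ⟨b, hb⟩ : ∃ b, i + 1 + a = l + 1 + b := ⟨i + 1 + a - l - 1, by omega⟩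
    have e1 : v ^ (i + 1) * u ^ (i + 1 + a - (i + 1)) = v ^ i * u ^ a * v := by
      rw [Nat.add_sub_cancel_left, pow_succ, mul_assoc, mul_assoc, (huv.pow_left a).eq]
    have e2 : v ^ i * u ^ (i + 1 + a - i) = v ^ i * u ^ a * u := by
      rw [show i + 1 + a - i = a + 1 by omega, pow_succ, mul_assoc]
    have e3 : v ^ (l + 1) * u ^ (i + 1 + a - (l + 1)) = v ^ l * u ^ b * v := by
      rw [hb, Nat.add_sub_cancel_left, pow_succ, mul_assoc, mul_assoc, (huv.pow_left b).eq]
    have e4 : v ^ l * u ^ (i + 1 + a - l) = v ^ l * u ^ b * u := by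
      rw [show i + 1 + a - l = b + 1 by omega, pow_succ, mul_assoc]
    simp only [e1, e2, e3, e4]
    have := h (y * x * (v ^ l * u ^ b))
    calc x * (v ^ i * u ^ a * v) * y * (x * (v ^ l * u ^ b * u) * y)
        = x * (v ^ i * u ^ a) * (v * (y * x * (v ^ l * u ^ b)) * u) * y := by
          simp only [mul_assoc]
      _ = x * (v ^ i * u ^ a) * (u * (y * x * (v ^ l * u ^ b)) * v) * y := by rw [this]
      _ = _ := by simp only [mul_assoc]

end Good

theorem sum_pow_p {A : Type*} [Ring A] {p : ℕ} (hp : p.Prime) (hc : (p : A) = 0) {ι : Type*}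
    (s : Finset ι) (f : ι → A) (h : ∀ i ∈ s, ∀ l ∈ s, Commute (f i) (f l)) (n : ℕ) :
    (∑ i ∈ s, f i) ^ p ^ n = ∑ i ∈ s, f i ^ p ^ n := by
  classical
  induction s using Finset.induction_on with
  | empty => simp [hp.ne_zero]
  | insert a s ha ih =>
    rw [Finset.sum_insert ha, Finset.sum_insert ha, add_pow_p hp hc, ih]
    · exact fun i hi l hl => h i (Finset.mem_insert_of_mem hi) l (Finset.mem_insert_of_mem hl)
    · exact Commute.sum_right _ _ _ fun i hi =>
        h a (Finset.mem_insert_self _ _) i (Finset.mem_insert_of_mem hi)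

/-- sums of two-sided multiplications raised to a power of `p` -/
theorem two_sided_pow {R : Type*} [Ring R] {p : ℕ} (hp : p.Prime) (hc : (p : R) = 0)
    {I : AddSubgroup R} (s : Finset ℕ) (f t : ℕ → R) (hf : ∀ i ∈ s, ∀ l ∈ s, Commute (f i) (f l))
    (ht : ∀ i ∈ s, ∀ l ∈ s, Commute (t i) (t l)) (n : ℕ)
    (h : ∀ b ∈ I, ∑ i ∈ s, f i * b * t i = 0) :
    ∀ b ∈ I, ∑ i ∈ s, f i ^ p ^ n * b * t i ^ p ^ n = 0 := by
  intro b hb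
  let T : ℕ → Module.End ℤ R := fun i => LinearMap.mulLeft ℤ (f i) * LinearMap.mulRight ℤ (t i)
  have hT : ∀ i b, T i b = f i * b * t i := fun i b => by simp [T, mul_assoc]
  have hTp : ∀ i m b, (T i ^ m) b = f i ^ m * b * t i ^ m := by
    intro i m
    induction m with
    | zero => simp
    | succ m ih =>
      intro b
      rw [pow_succ, Module.End.mul_apply, ih, hT, pow_succ, pow_succ']
      simp only [mul_assoc]
  have hchar : (p : Module.End ℤ R) = 0 := by
    ext b
    rw [Module.End.natCast_apply, nsmul_eq_mul, hc, zero_mul]; rfl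
  have hcomm : ∀ i ∈ s, ∀ l ∈ s, Commute (T i) (T l) := by
    intro i hi l hl
    ext b
    change T i (T l b) = T l (T i b)
    rw [hT, hT, hT, hT]
    have h1 := (hf i hi l hl).eq
    have h2 := (ht i hi l hl).eq
    calc f i * (f l * b * t l) * t i = (f i * f l) * b * (t l * t i) := by simp only [mul_assoc]
      _ = (f l * f i) * b * (t i * t l) := by rw [h1, h2]
      _ = _ := by simp only [mul_assoc]
  have key := sum_pow_p hp hchar s T hcomm n
  have h0 : (∑ i ∈ s, T i) b = 0 := by
    rw [LinearMap.sum_apply, ← h b hb]; exact Finset.sum_congr rfl fun i _ => hT i b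
  obtain ⟨m, hm⟩ := Nat.exists_eq_succ_of_ne_zero (pow_ne_zero n hp.ne_zero)
  have h1 : ((∑ i ∈ s, T i) ^ p ^ n) b = 0 := by
    rw [hm, pow_succ, Module.End.mul_apply, h0, map_zero]
  rw [key, LinearMap.sum_apply] at h1
  rw [← h1]
  exact Finset.sum_congr rfl fun i _ => (hTp i _ b).symm

theorem vander {R : Type*} [Ring R] {p : ℕ} [Algebra (ZMod p) R] (θ : R) (d : ℕ) (ex : ℕ → ℕ)
    (c : ℕ → R) (h : ∀ i ≤ d, ∑ j ∈ Finset.range (d + 1), c j * θ ^ (j * ex i) = 0) :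
    c d * Polynomial.aeval θ (∏ i : Fin (d + 1), ∏ l ∈ Finset.Ioi i,
      ((Polynomial.X : Polynomial (ZMod p)) ^ ex l - Polynomial.X ^ ex i)) = 0 := by
  classical
  let v : Fin (d + 1) → Polynomial (ZMod p) := fun i => Polynomial.X ^ ex i
  have hdet := Matrix.det_vandermonde v
  set W := Matrix.vandermonde v with hW
  have hadj := Matrix.adjugate_mul W
  have hrow : ∀ i : Fin (d + 1), ∑ j : Fin (d + 1), c j * Polynomial.aeval θ (W i j) = 0 := by
    intro i
    rw [← h i (by omega), Finset.sum_range]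
    refine Finset.sum_congr rfl fun j _ => ?_
    simp only [hW, Matrix.vandermonde_apply, v, map_pow, Polynomial.aeval_X]
    rw [← pow_mul, mul_comm (ex i)]
  change c d * Polynomial.aeval θ (∏ i : Fin (d + 1), ∏ l ∈ Finset.Ioi i, (v l - v i)) = 0
  rw [← hdet]
  have hent : ∀ j : Fin (d + 1), ∑ i, W.adjugate (Fin.last d) i * W i j =
      if Fin.last d = j then W.det else 0 := by
    intro j
    have := congrFun (congrFun hadj (Fin.last d)) j
    rw [Matrix.mul_apply, Matrix.smul_apply, Matrix.one_apply] at this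
    rw [this]; split_ifs <;> simp
  have : ∑ j : Fin (d + 1), c j * Polynomial.aeval θ (if Fin.last d = j then W.det else 0) = 0 := by
    simp_rw [← hent, map_sum, Finset.mul_sum]
    rw [Finset.sum_comm]
    refine Finset.sum_eq_zero fun i _ => ?_
    have := congrArg (· * Polynomial.aeval θ (W.adjugate (Fin.last d) i)) (hrow i)
    simp only [zero_mul, Finset.sum_mul] at this
    rw [← this]
    refine Finset.sum_congr rfl fun j _ => ?_
    rw [mul_comm (W.adjugate _ _), map_mul, mul_assoc]
  rw [Finset.sum_eq_single (Fin.last d)] at this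
  · simpa using this
  · intro j _ hj
    rw [if_neg hj.symm]; simp
  · simp

theorem dvd_frob {A : Type*} [CommRing A] {p : ℕ} (hp : p.Prime) (hc : (p : A) = 0) (x : A)
    (e t : ℕ) : x ^ p ^ e - x ∣ x ^ p ^ (e * t) - x := by
  induction t with
  | zero => simp
  | succ t ih =>
    have : x ^ p ^ (e * (t + 1)) - x = (x ^ p ^ e - x) ^ p ^ (e * t) + (x ^ p ^ (e * t) - x) := by
      rw [sub_pow_p hp hc (Commute.all _ _), ← pow_mul, ← pow_add, mul_add, mul_one, add_comm e]
      ring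
    rw [this]
    exact dvd_add (dvd_pow_self _ (pow_ne_zero _ hp.ne_zero)) ih

theorem dvd_vander {A : Type*} [CommRing A] {p : ℕ} (hp : p.Prime) (hc : (p : A) = 0) (x : A)
    (d f Q : ℕ) (hd : d < Q) :
    (∏ i : Fin (d + 1), ∏ l ∈ Finset.Ioi i, (x ^ p ^ (f * l) - x ^ p ^ (f * i))) ∣
      (x ^ p ^ (f * Q.factorial) - x) ^ (Q * (Q * p ^ (f * Q))) := by
  have h1 : ∀ i l : ℕ, i < l → l ≤ d → x ^ p ^ (f * l) - x ^ p ^ (f * i) ∣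
      (x ^ p ^ (f * Q.factorial) - x) ^ (p ^ (f * Q)) := by
    intro i l hil hl
    obtain ⟨e, rfl⟩ := Nat.exists_eq_add_of_lt hil
    have e1 : x ^ p ^ (f * (i + e + 1)) - x ^ p ^ (f * i) =
        (x ^ p ^ (f * (e + 1)) - x) ^ p ^ (f * i) := by
      rw [sub_pow_p hp hc (Commute.all _ _), ← pow_mul, ← pow_add]
      congr 3; ring
    rw [e1]
    obtain ⟨t, ht⟩ := Nat.dvd_factorial (m := e + 1) (n := Q) (by omega) (by omega)
    have h2 := dvd_frob hp hc x (f * (e + 1)) t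
    rw [mul_assoc, ← ht] at h2
    refine (pow_dvd_pow_of_dvd h2 _).trans (pow_dvd_pow _ (Nat.pow_le_pow_right hp.pos ?_))
    exact Nat.mul_le_mul_left _ (by omega)
  set D := (x ^ p ^ (f * Q.factorial) - x) with hD
  have h2 : ∀ i : Fin (d + 1), (∏ l ∈ Finset.Ioi i, (x ^ p ^ (f * l) - x ^ p ^ (f * i))) ∣
      D ^ (Q * p ^ (f * Q)) := by
    intro i
    refine (Finset.prod_dvd_prod_of_dvd _ (fun _ => D ^ p ^ (f * Q)) fun l hl => ?_).trans ?_
    · exact h1 i l (by simpa using hl) (by omega)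
    · rw [Finset.prod_const, ← pow_mul, mul_comm]
      refine pow_dvd_pow _ (Nat.mul_le_mul_right _ ?_)
      refine (Finset.card_le_univ _).trans ?_
      simp; omega
  refine (Finset.prod_dvd_prod_of_dvd _ (fun _ => D ^ (Q * p ^ (f * Q))) fun i _ => h2 i).trans ?_
  rw [Finset.prod_const, ← pow_mul, mul_comm]
  refine pow_dvd_pow _ (Nat.mul_le_mul_right _ ?_)
  simp; omega

end WnP


namespace WnP
namespace Good
variable {R V : Type*} [Ring R] [AddCommGroup V] {p j : ℕ} {S : AddSubgroup R} {L : R →+ V}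

theorem frob_rel (g : Good p j S L) {I : AddSubgroup R} (hIS : I ≤ S) (d : ℕ) (v : ℕ → R)
    (θ : R) (hvI : ∀ i, v i ∈ I)
    (hsw : ∀ r, ∀ i ≤ d, ∀ l ≤ d, v i * r * v l = v l * r * v i)
    (h0 : ∀ b ∈ I, ∑ e ∈ Finset.range (d + 1), v e * b * θ ^ e = 0) (i : ℕ) :
    ∃ κ, ∀ b ∈ I, ∑ e ∈ Finset.range (d + 1),
      v e * v d ^ κ * b * θ ^ (e * p ^ (2 * j * i)) = 0 := by
  have hcm : ∀ i ≤ d, ∀ l ≤ d, Commute (v i) (v l) := by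
    intro i hi l hl
    have := hsw 1 i hi l hl
    rwa [mul_one, mul_one] at this
  induction i with
  | zero => exact ⟨0, fun b hb => by simpa using h0 b hb⟩
  | succ i ih =>
    obtain ⟨κ, hκ⟩ := ih
    have hN2 := g.two_le_N
    set N := p ^ (2 * j) with hN
    refine ⟨κ * N + (N * N - 1), fun b hb => ?_⟩
    have h1 := two_sided_pow g.prime g.char (Finset.range (d + 1)) (fun e => v e * v d ^ κ)
      (fun e => θ ^ (e * p ^ (2 * j * i))) ?_ ?_ (2 * j) hκ b hb
    · have h2 := congrArg (v d ^ (N * N - N) * ·) h1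
      simp only [mul_zero, Finset.mul_sum] at h2
      rw [← h2]
      refine Finset.sum_congr rfl fun e he => ?_
      have he' : e ≤ d := by simpa [Nat.lt_succ_iff] using he
      rw [← hN]
      have hc := hcm e he' d le_rfl
      have h3 := g.chain2 (v d) (v e) (hIS (hvI d)) (hIS (hvI e))
        (fun r => hsw r d le_rfl e he') _ rfl
      rw [← hN] at h3
      have h4 : v d ^ (N * N - N) * (v e * v d ^ κ) ^ N = v e * v d ^ (κ * N + (N * N - 1)) := by
        rw [(hc.pow_right κ).mul_pow, ← pow_mul, ← mul_assoc,
          ← (hc.pow_pow N (N * N - N)).eq, h3, mul_assoc, ← pow_add, add_comm]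
      rw [← h4, ← pow_mul]
      rw [show e * p ^ (2 * j * (i + 1)) = e * p ^ (2 * j * i) * N by
        rw [hN, mul_add, pow_add, mul_one]; ring]
      simp only [mul_assoc]
    · intro a ha b hb
      have ha' : a ≤ d := by simpa [Nat.lt_succ_iff] using ha
      have hb' : b ≤ d := by simpa [Nat.lt_succ_iff] using hb
      exact ((hcm a ha' b hb').mul_right ((hcm a ha' d le_rfl).pow_right κ)).mul_left
        (((hcm b hb' d le_rfl).symm.pow_left κ).mul_right (Commute.refl _))
    · intro a _ b _
      exact (Commute.refl θ).pow_pow _ _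

theorem algebraic (g : Good p j S L) {θ : R} (hθ : θ ∈ S) :
    (θ ^ p ^ (2 * j * (p ^ j).factorial) - θ) ^
      (p ^ j * (p ^ j * p ^ (2 * j * p ^ j))) = 0 := by
  classical
  by_contra hw
  set w := (θ ^ p ^ (2 * j * (p ^ j).factorial) - θ) ^
      (p ^ j * (p ^ j * p ^ (2 * j * p ^ j))) with hwdef
  have : Nontrivial R := ⟨⟨w, 0, hw⟩⟩
  have : CharP R p := (CharP.charP_iff_prime_eq_zero g.prime).2 g.char
  let _ : Algebra (ZMod p) R := ZMod.algebra R p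
  have hp0 := g.prime.pos
  have hwS : w ∈ S := by
    refine g.pow_mem (S.sub_mem (g.pow_mem hθ (by positivity)) hθ) (by positivity)
  let I : AddSubgroup R := AddSubgroup.closure {z | ∃ x y, z = x * w * y}
  have hIS : I ≤ S := by
    refine (AddSubgroup.closure_le _).2 ?_
    rintro _ ⟨x, y, rfl⟩
    exact g.mulR _ _ (g.mulL _ _ hwS)
  have hl : ∀ r s : R, s ∈ I → r * s ∈ I := by
    intro r s hs
    refine AddSubgroup.closure_induction (p := fun s _ => r * s ∈ I) ?_ ?_ ?_ ?_ hs
    · rintro _ ⟨x, y, rfl⟩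
      exact AddSubgroup.subset_closure ⟨r * x, y, by simp only [mul_assoc]⟩
    · rw [mul_zero]; exact I.zero_mem
    · intro a b _ _ ha hb; rw [mul_add]; exact I.add_mem ha hb
    · intro a _ ha; rw [mul_neg]; exact I.neg_mem ha
  have hr : ∀ s r : R, s ∈ I → s * r ∈ I := by
    intro s r hs
    refine AddSubgroup.closure_induction (p := fun s _ => s * r ∈ I) ?_ ?_ ?_ ?_ hs
    · rintro _ ⟨x, y, rfl⟩
      exact AddSubgroup.subset_closure ⟨x, y * r, by simp only [mul_assoc]⟩
    · rw [zero_mul]; exact I.zero_mem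
    · intro a b _ _ ha hb; rw [add_mul]; exact I.add_mem ha hb
    · intro a _ ha; rw [neg_mul]; exact I.neg_mem ha
  have hwI : w ∈ I := AddSubgroup.subset_closure ⟨1, 1, by simp⟩
  have hI : I ≠ ⊥ := by
    intro h
    rw [h] at hwI
    exact hw ((AddSubgroup.mem_bot).1 hwI)
  have hex : ∃ d, d < p ^ j ∧ ∃ U, Ann I θ d U ∧ U d ≠ 0 := exists_Ann hl hr hI (p ^ j)
    (fun a s hs ha => g.Sy_eq_zero a s hs fun i hi => hIS (ha i hi)) θ
  set d := Nat.find hex with hd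
  obtain ⟨hdQ, U, hU, hUd⟩ := Nat.find_spec hex
  rw [← hd] at hdQ hU hUd
  have hmin : ∀ e < d, ∀ U, Ann I θ e U → U e = 0 := by
    intro e he U' hU'
    by_contra hne
    exact Nat.find_min hex he ⟨he.trans hdQ, U', hU', hne⟩
  refine hUd (g.eq_zero_of_nil (hIS (hU.1 d)) fun x => ?_)
  set v : ℕ → R := fun e => U e * x with hv
  have hvA : Ann I θ d v := hU.right hl hr x
  have hsw : ∀ r, ∀ i ≤ d, ∀ l ≤ d, v i * r * v l = v l * r * v i := by
    intro r i hi l hl'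
    exact Ann.swap hl hr hmin hvA r hi hl'
  have hcm : ∀ i ≤ d, ∀ l ≤ d, Commute (v i) (v l) := by
    intro i hi l hl
    have := hsw 1 i hi l hl
    rwa [mul_one, mul_one] at this
  choose κ hκ using g.frob_rel hIS d v θ hvA.1 hsw hvA.2
  set k := ∑ i ∈ Finset.range (d + 1), κ i with hk
  have hkey : ∀ b ∈ I, v d ^ (k + 1) * b * w = 0 := by
    intro b hb
    have h1 := vander (p := p) θ d (fun i => p ^ (2 * j * i)) (fun e => v e * v d ^ k * b) ?_
    · obtain ⟨c, hc⟩ := dvd_vander g.prime (A := Polynomial (ZMod p))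
        (by exact_mod_cast CharP.cast_eq_zero (Polynomial (ZMod p)) p) Polynomial.X d (2 * j)
        (p ^ j) hdQ
      have h2 := congrArg (Polynomial.aeval θ) hc
      rw [map_mul, map_pow, map_sub, map_pow, Polynomial.aeval_X, ← hwdef] at h2
      rw [h2, ← mul_assoc, pow_succ', h1, zero_mul]
    · intro i hi
      obtain ⟨t, ht⟩ := Nat.exists_eq_add_of_le
        (Finset.single_le_sum (f := κ) (fun _ _ => Nat.zero_le _)
          (Finset.mem_range.2 (Nat.lt_succ_iff.2 hi)))
      have h2 := congrArg (v d ^ t * ·) (hκ i b hb)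
      simp only [mul_zero, Finset.mul_sum] at h2
      rw [← h2]
      refine Finset.sum_congr rfl fun e he => ?_
      have he' : e ≤ d := by simpa [Nat.lt_succ_iff] using he
      rw [hk, ht, add_comm (κ i), pow_add]
      have := ((hcm e he' d le_rfl).pow_right t).eq
      simp only [← mul_assoc]
      rw [this]
  have hkey2 : ∀ b ∈ I, ∀ h ∈ I, v d ^ (k + 1) * b * h = 0 := by
    intro b hb h hh
    refine AddSubgroup.closure_induction (p := fun h _ => v d ^ (k + 1) * b * h = 0)
      ?_ ?_ ?_ ?_ hh
    · rintro _ ⟨x, y, rfl⟩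
      have := hkey (b * x) (hr _ _ hb)
      calc v d ^ (k + 1) * b * (x * w * y) = v d ^ (k + 1) * (b * x) * w * y := by
            simp only [mul_assoc]
        _ = 0 := by rw [this, zero_mul]
    · simp
    · intro a b _ _ ha hb; rw [mul_add, ha, hb, add_zero]
    · intro a _ ha; rw [mul_neg, ha, neg_zero]
  refine ⟨k + 1 + 1 + 1, ?_⟩
  have := hkey2 _ (hvA.1 d) _ (hvA.1 d)
  rw [pow_succ, pow_succ]; exact this

end Good
end WnP


namespace WnP

theorem map_pow_nu {D R : Type*} [Ring D] [Ring R] (ψ : D →ₙ+* R) (c : D) {n : ℕ} (hn : n ≠ 0) :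
    ψ (c ^ n) = ψ c ^ n := by
  obtain ⟨m, rfl⟩ := Nat.exists_eq_succ_of_ne_zero hn
  induction m with
  | zero => simp
  | succ m ih => rw [Nat.succ_eq_add_one, pow_succ, map_mul, ih (by omega), ← pow_succ]

theorem field_piece.{u} {R : Type u} [Ring R] (T : NonUnitalSubring R) [Finite T] (M : ℕ) (hM : 2 ≤ M)
    (hT : ∀ c ∈ T, c ^ M = c) (P : R → Prop) (hP0 : ¬ P 0)
    (hPadd : ∀ e ∈ T, ∀ f ∈ T, e * e = e → f * f = f → P (e + f) → P e ∨ P f)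
    (hex : ∃ e ∈ T, e * e = e ∧ P e) :
    ∃ (F : Type u) (_ : Field F) (_ : Finite F) (φ : F →ₙ+* R), Function.Injective φ ∧
      (∀ f, φ f ∈ T) ∧ (∀ r ∈ T, ∃ f, φ f = φ 1 * r) ∧ (∀ r ∈ T, φ 1 * r = r * φ 1) ∧
      P (φ 1) := by
  classical
  have hred : ∀ z ∈ T, z * z = 0 → z = 0 := by
    intro z hz h
    rw [← hT z hz, pow_eq_zero_of_le hM (by rw [pow_two, h])]
  have hcent : ∀ e ∈ T, e * e = e → ∀ r ∈ T, e * r = r * e := by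
    intro e he hee r hr
    have h1 : e * r - e * r * e = 0 := by
      refine hred _ (T.sub_mem (T.mul_mem he hr) (T.mul_mem (T.mul_mem he hr) he)) ?_
      have e1 : (e * r - e * r * e) * (e * r - e * r * e) =
        e * r * (e * r) - e * r * (e * e) * r - e * r * (e * r * e) + e * r * (e * e) * r * e := by
        noncomm_ring
      rw [e1, hee]; noncomm_ring
    have h2 : r * e - e * r * e = 0 := by
      refine hred _ (T.sub_mem (T.mul_mem hr he) (T.mul_mem (T.mul_mem he hr) he)) ?_
      have e1 : (r * e - e * r * e) * (r * e - e * r * e) =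
        r * e * r * e - r * (e * e) * r * e - e * r * e * r * e + e * r * (e * e) * r * e := by
        noncomm_ring
      rw [e1, hee]; noncomm_ring
    rw [sub_eq_zero.1 h1, sub_eq_zero.1 h2]
  let E : R → Set R := fun e => {z | z ∈ T ∧ e * z = z}
  have hEfin : ∀ e, (E e).Finite := fun e =>
    Set.Finite.subset (Set.toFinite (T : Set R)) fun z hz => hz.1
  have hex' : ∃ n, ∃ e ∈ T, e * e = e ∧ P e ∧ (E e).ncard = n := by
    obtain ⟨e, h1, h2, h3⟩ := hex
    exact ⟨_, e, h1, h2, h3, rfl⟩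
  obtain ⟨e, heT, hee, hPe, hcard⟩ := Nat.find_spec hex'
  have hmin : ∀ f ∈ T, f * f = f → P f → e * f = f → f = e := by
    intro f hf hff hPf hef
    by_contra hne
    have hlt : (E f).ncard < (E e).ncard := by
      refine Set.ncard_lt_ncard ⟨?_, fun hsub => ?_⟩ (hEfin e)
      · rintro z ⟨hz, hfz⟩
        exact ⟨hz, by rw [← hfz, ← mul_assoc, hef]⟩
      · have : e ∈ E f := hsub ⟨heT, hee⟩
        apply hne
        rw [← hef, ← hcent f hf hff e heT, this.2]
    rw [hcard] at hlt
    exact Nat.find_min hex' hlt ⟨f, hf, hff, hPf, rfl⟩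
  have hprim : ∀ f ∈ T, f * f = f → e * f = f → f = 0 ∨ f = e := by
    intro f hf hff hef
    have hfe : f * e = f := by rw [hcent f hf hff e heT, hef]
    have h2 : (e - f) * (e - f) = e - f := by
      rw [sub_mul, mul_sub, mul_sub, hee, hef, hfe, hff]; simp
    rcases hPadd f hf (e - f) (T.sub_mem heT hf) hff h2 (by simpa using hPe) with h | h
    · exact Or.inr (hmin f hf hff h hef)
    · left
      have := hmin (e - f) (T.sub_mem heT hf) h2 h (by rw [mul_sub, hee, hef])
      simpa using this
  let eT : T := ⟨e, heT⟩
  have hid : IsIdempotentElem eT := Subtype.ext hee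
  let ψ : hid.Corner →ₙ+* R :=
    { toFun := fun c => ((c.1 : T) : R)
      map_mul' := fun _ _ => rfl
      map_zero' := rfl
      map_add' := fun _ _ => rfl }
  have hψinj : Function.Injective ψ := fun a b h => Subtype.ext (Subtype.ext h)
  have hψ1 : ψ 1 = e := rfl
  have hψT : ∀ c, ψ c ∈ T := fun c => c.1.2
  have hψe : ∀ c, e * ψ c = ψ c := fun c => by rw [← hψ1, ← map_mul, one_mul]
  have : Finite hid.Corner := Finite.of_injective (fun c => (⟨ψ c, hψT c⟩ : T))
    fun a b h => hψinj (congrArg Subtype.val h)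
  have hpowM : ∀ c : hid.Corner, c ^ M = c := fun c => hψinj (by
    rw [map_pow_nu ψ c (by omega), hT _ (hψT c)])
  have he0 : e ≠ 0 := fun h => hP0 (h ▸ hPe)
  have hidem : ∀ c : hid.Corner, c * c = c → c = 0 ∨ c = 1 := by
    intro c hc
    rcases hprim (ψ c) (hψT c) (by rw [← map_mul, hc]) (hψe c) with h | h
    · exact Or.inl (hψinj (by rw [h, map_zero]))
    · exact Or.inr (hψinj (by rw [h, hψ1]))
  obtain ⟨m, rfl⟩ : ∃ m, M = m + 2 := ⟨M - 2, by omega⟩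
  have hinv : ∀ c : hid.Corner, c ≠ 0 → c ^ (m + 1) = 1 := by
    intro c hc
    refine (hidem (c ^ (m + 1)) ?_).resolve_left fun h => ?_
    · rw [← pow_add, show m + 1 + (m + 1) = m + 2 + m by ring, pow_add, hpowM, ← pow_succ']
    · apply hc
      rw [← hpowM c, pow_succ, h, zero_mul]
  have hnt : Nontrivial hid.Corner := ⟨⟨1, 0, fun h => he0 (by rw [← hψ1, h, map_zero])⟩⟩
  have hnz : NoZeroDivisors hid.Corner := ⟨fun {a b} hab => by
    by_cases ha : a = 0
    · exact Or.inl ha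
    · right
      rw [← one_mul b, ← hinv a ha, pow_succ, mul_assoc, hab, mul_zero]⟩
  have hdom : IsDomain hid.Corner := NoZeroDivisors.to_isDomain _
  have hF := Finite.isDomain_to_isField hid.Corner
  refine ⟨hid.Corner, hF.toField, this, ψ, hψinj, hψT, ?_, ?_, ?_⟩
  · intro r hr
    refine ⟨⟨⟨e * r, T.mul_mem heT hr⟩, ?_⟩, rfl⟩
    refine (Subsemigroup.mem_corner_iff hid).2 ⟨Subtype.ext ?_, Subtype.ext ?_⟩
    · change e * (e * r) = e * r
      rw [← mul_assoc, hee]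
    · change e * r * e = e * r
      rw [mul_assoc, ← hcent e heT hee r hr, ← mul_assoc, hee]
  · exact fun r hr => hcent e heT hee r hr
  · exact hPe

end WnP


namespace WnP

theorem finite_closure {R : Type*} [Ring R] {p : ℕ} (hp : p ≠ 0) (hc : (p : R) = 0) (G : Set R)
    (hG : G.Finite) (hmul : ∀ a ∈ G, ∀ b ∈ G, a * b ∈ G) :
    ∃ T : NonUnitalSubring R, Finite T ∧ (T : Set R) = AddSubgroup.closure G := by
  let H := AddSubgroup.closure G
  have hm : ∀ a ∈ H, ∀ b ∈ H, a * b ∈ H := by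
    intro a ha b hb
    refine AddSubgroup.closure_induction (p := fun a _ => a * b ∈ H) ?_ ?_ ?_ ?_ ha
    · intro x hx
      refine AddSubgroup.closure_induction (p := fun b _ => x * b ∈ H) ?_ ?_ ?_ ?_ hb
      · exact fun y hy => AddSubgroup.subset_closure (hmul x hx y hy)
      · rw [mul_zero]; exact H.zero_mem
      · intro a b _ _ ha hb; rw [mul_add]; exact H.add_mem ha hb
      · intro a _ ha; rw [mul_neg]; exact H.neg_mem ha
    · rw [zero_mul]; exact H.zero_mem
    · intro a b _ _ ha hb; rw [add_mul]; exact H.add_mem ha hb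
    · intro a _ ha; rw [neg_mul]; exact H.neg_mem ha
  have : Finite G := hG
  have hfin : Finite H := by
    have h1 : AddGroup.FG H := AddGroup.closure_finite_fg G
    have h2 : IsAddTorsion H := by
      intro a
      rw [isOfFinAddOrder_iff_nsmul_eq_zero]
      refine ⟨p, Nat.pos_of_ne_zero hp, Subtype.ext ?_⟩
      simp [hc]
    exact AddCommGroup.finite_of_fg_isAddTorsion _ h2
  exact ⟨{ H with mul_mem' := fun ha hb => hm _ ha _ hb }, hfin, rfl⟩

theorem pow_card_eq {F : Type*} [Field F] [Finite F] {p j : ℕ} [Fact p.Prime] [CharP F p]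
    (hj : 1 ≤ j) (h : ∀ z : FiniteField.Extension F p 2, z ^ p ^ (2 * j) = z) (c : F) :
    c ^ p ^ j = c := by
  have hp := Fact.out (p := p.Prime)
  have := Fintype.ofFinite F
  obtain ⟨s, _, hs⟩ := FiniteField.card F p
  have hK := FiniteField.natCard_extension F p 2
  have : Finite (FiniteField.Extension F p 2) := Module.finite_of_finite F
  have := Fintype.ofFinite (FiniteField.Extension F p 2)
  rw [Nat.card_eq_fintype_card (α := F), hs, ← pow_mul] at hK
  obtain ⟨u, hu⟩ := IsCyclic.exists_generator (α := (FiniteField.Extension F p 2)ˣ)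
  have ho : orderOf u = p ^ ((s : ℕ) * 2) - 1 := by
    rw [orderOf_eq_card_of_forall_mem_zpowers hu, Nat.card_units, hK]
  have hu1 : u ^ (p ^ (2 * j) - 1) = 1 := by
    have h1 : u ^ p ^ (2 * j) = u := Units.ext (by simpa using h u)
    have h2 : p ^ (2 * j) = (p ^ (2 * j) - 1) + 1 := by
      have : 0 < p ^ (2 * j) := pow_pos hp.pos _
      omega
    rw [h2, pow_succ] at h1
    simpa using h1
  have hdvd := orderOf_dvd_of_pow_eq_one hu1
  rw [ho] at hdvd
  have hg := Nat.pow_sub_one_gcd_pow_sub_one p (s * 2) (2 * j)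
  rw [Nat.gcd_eq_left hdvd] at hg
  have h3 : p ^ ((s : ℕ) * 2) = p ^ Nat.gcd (s * 2) (2 * j) := by
    have a1 : 0 < p ^ ((s : ℕ) * 2) := pow_pos hp.pos _
    have a2 : 0 < p ^ Nat.gcd (s * 2) (2 * j) := pow_pos hp.pos _
    omega
  have h4 := Nat.pow_right_injective hp.two_le h3
  have h5 : (s : ℕ) * 2 ∣ 2 * j := Nat.gcd_eq_left_iff_dvd.1 h4.symm
  obtain ⟨t, ht⟩ := h5
  have h6 : j = s * t := by nlinarith
  rw [h6, pow_mul, ← hs, FiniteField.pow_card_pow]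

namespace Good
variable {R V : Type*} [Ring R] [AddCommGroup V] {p j : ℕ} {S : AddSubgroup R} {L : R →+ V}

theorem mat2 (g : Good p j S L) {F : Type*} [Field F] [Finite F] (φ : F →ₙ+* R)
    (hinj : Function.Injective φ) (hS : ∀ f, φ f ∈ S) (a b : R)
    (hba : b * a = φ 1) (h1a : φ 1 * a = 0) (hb1 : b * φ 1 = 0) (h1b : φ 1 * b = b)
    (ha1 : a * φ 1 = a) (f : F) : L (φ f) = 0 := by
  have : Fact p.Prime := ⟨g.prime⟩
  have hcF : (p : F) = 0 := hinj (by
    have : ((p : ℕ) : F) = p • (1 : F) := by simp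
    rw [this, map_nsmul, map_zero, nsmul_eq_mul, g.char, zero_mul])
  have : CharP F p := (CharP.charP_iff_prime_eq_zero g.prime).2 hcF
  have hφ1 : ∀ f, φ 1 * φ f = φ f := fun f => by rw [← map_mul, one_mul]
  have hφ1' : ∀ f, φ f * φ 1 = φ f := fun f => by rw [← map_mul, mul_one]
  have hφa : ∀ f, φ f * a = 0 := fun f => by rw [← hφ1', mul_assoc, h1a, mul_zero]
  have hbφ : ∀ f, b * φ f = 0 := fun f => by rw [← hφ1, ← mul_assoc, hb1, zero_mul]
  -- the matrix representation
  let ρ : Matrix (Fin 2) (Fin 2) F → R := fun m =>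
    φ (m 0 0) + φ (m 0 1) * b + a * φ (m 1 0) + a * φ (m 1 1) * b
  have hρS : ∀ m, ρ m ∈ S := fun m => S.add_mem (S.add_mem (S.add_mem (hS _)
    (g.mulR _ _ (hS _))) (g.mulL _ _ (hS _))) (g.mulR _ _ (g.mulL _ _ (hS _)))
  have hρmul : ∀ m n, ρ (m * n) = ρ m * ρ n := by
    intro m n
    have hba' : ∀ z, b * (a * z) = φ 1 * z := fun z => by rw [← mul_assoc, hba]
    have hφa' : ∀ f z, φ f * (a * z) = 0 := fun f z => by rw [← mul_assoc, hφa, zero_mul]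
    have hbφ' : ∀ f z, b * (φ f * z) = 0 := fun f z => by rw [← mul_assoc, hbφ, zero_mul]
    have hphim : ∀ f z, φ 1 * (φ f * z) = φ f * z := fun f z => by rw [← mul_assoc, hφ1]
    simp only [ρ, Matrix.mul_apply, Fin.sum_univ_two, map_add, map_mul, mul_add, add_mul,
      mul_assoc, hba', hφa', hbφ', hbφ, hphim, hφ1, mul_zero, add_zero, zero_add]
    abel
  have hρadd : ∀ m n, ρ (m + n) = ρ m + ρ n := by
    intro m n
    simp only [ρ, Matrix.add_apply, map_add, mul_add, add_mul]
    abel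
  have hL1 : ∀ c, L (φ c * b) = 0 := fun c => g.sqz (g.mulR _ _ (hS _)) (by
    rw [mul_assoc, ← mul_assoc b, hbφ, zero_mul, mul_zero])
  have hL2 : ∀ c, L (a * φ c) = 0 := fun c => g.sqz (g.mulL _ _ (hS _)) (by
    rw [mul_assoc, ← mul_assoc (φ c), hφa, zero_mul, mul_zero])
  have hL3 : ∀ c, L (a * φ c * b) = L (φ c) := by
    intro c
    have h0 : (φ 1 + b) * (φ 1 - a) = 0 := by
      rw [add_mul, mul_sub, mul_sub, hφ1, h1a, hb1, hba]; simp
    have h1 : L ((φ 1 - a) * φ c * (φ 1 + b)) = 0 := by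
      refine g.sqz (g.mulR _ _ (g.mulL _ _ (hS _))) ?_
      calc (φ 1 - a) * φ c * (φ 1 + b) * ((φ 1 - a) * φ c * (φ 1 + b))
          = (φ 1 - a) * φ c * ((φ 1 + b) * (φ 1 - a)) * φ c * (φ 1 + b) := by
            simp only [mul_assoc]
        _ = 0 := by rw [h0]; simp
    have h2 : (φ 1 - a) * φ c * (φ 1 + b) = φ c + φ c * b - a * φ c - a * φ c * b := by
      rw [sub_mul, hφ1, mul_add, sub_mul, sub_mul, hφ1', mul_assoc a (φ c) (φ 1), hφ1']
      abel
    rw [h2, map_sub, map_sub, map_add, hL1, hL2, add_zero, sub_zero, sub_eq_zero] at h1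
    exact h1.symm
  have hLρ : ∀ m, L (ρ m) = L (φ (Matrix.trace m)) := by
    intro m
    simp only [ρ, map_add, hL1, hL2, hL3, Matrix.trace_fin_two, add_zero]
  let K := FiniteField.Extension F p 2
  let B : Module.Basis (Fin 2) F K :=
    Module.finBasisOfFinrankEq F K (FiniteField.finrank_extension F p 2)
  let θ : K →ₙ+* R :=
    { toFun := fun z => ρ (Algebra.leftMulMatrix B z)
      map_mul' := fun x y => by rw [map_mul, hρmul]
      map_add' := fun x y => by rw [map_add, hρadd]
      map_zero' := by simp [ρ] }
  have hθ : ∀ z, L (θ z) = L (φ (Algebra.trace F K z)) := fun z => by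
    rw [Algebra.trace_eq_matrix_trace B]; exact hLρ _
  have hθS : ∀ z, θ z ∈ S := fun z => hρS _
  have hp0 := g.prime.pos
  by_cases hall : ∀ z : K, z ^ p ^ (2 * j) = z
  · have hQ := pow_card_eq g.jpos hall
    have n1 : ∀ c, L (φ c) = - L (φ c) := fun c => by
      rw [← g.hQ _ (hS c), ← map_pow_nu φ c (by positivity), hQ]
    have n2 : ∀ c, L (φ (c * c)) = 0 := fun c => by
      have := g.hQ1 _ (hS c)
      rwa [← map_pow_nu φ c (by positivity), pow_succ, hQ] at this
    by_cases h2 : (2 : F) = 0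
    · have hch : ringChar F = 2 := by
        have h2' : ((2 : ℕ) : F) = 0 := by exact_mod_cast h2
        have : CharP F 2 := (CharP.charP_iff_prime_eq_zero Nat.prime_two).2 h2'
        exact ringChar.eq F 2
      obtain ⟨c, rfl⟩ := FiniteField.isSquare_of_char_two hch f
      exact n2 c
    · have : f = f / 2 + f / 2 := by field_simp; ring
      rw [this, map_add, map_add]
      nth_rewrite 1 [n1]
      simp
  · push Not at hall
    obtain ⟨β, hβ⟩ := hall
    have hz : ∀ z, L (θ z) = 0 := by
      intro z
      set δ := β ^ p ^ (2 * j) - β with hδ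
      have hδ0 : δ ≠ 0 := sub_ne_zero.2 hβ
      have e1 : z = (z / δ) * β ^ p ^ (2 * j) - (z / δ) * β := by
        rw [← mul_sub, ← hδ, div_mul_cancel₀ _ hδ0]
      have hc : Commute (θ (z / δ)) (θ β) := by
        change _ * _ = _ * _
        rw [← map_mul, mul_comm, map_mul]
      rw [e1, map_sub θ, map_sub L, map_mul θ, map_mul θ, map_pow_nu θ β (by positivity),
        g.comm (hθS _) (hθS _) hc, sub_self]
    obtain ⟨z, hz0⟩ : ∃ z : K, Algebra.trace F K z ≠ 0 := by
      by_contra hcon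
      push Not at hcon
      exact Algebra.trace_ne_zero F K (LinearMap.ext hcon)
    have := hz ((f / Algebra.trace F K z) • z)
    rwa [hθ, map_smul, smul_eq_mul, div_mul_cancel₀ _ hz0] at this

end Good
end WnP


namespace WnP

theorem pow_sum_comm {R : Type*} [Ring R] {p : ℕ} (hp : p.Prime) (hc : (p : R) = 0) (n : ℕ)
    (G : Set R) (hG : ∀ a ∈ G, ∀ b ∈ G, Commute a b) (hpow : ∀ a ∈ G, a ^ p ^ n = a) :
    ∀ c ∈ AddSubgroup.closure G, c ^ p ^ n = c := by
  have h1 : ∀ a ∈ G, ∀ c ∈ AddSubgroup.closure G, Commute a c := by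
    intro a ha c hc
    refine AddSubgroup.closure_induction (p := fun c _ => Commute a c) ?_ ?_ ?_ ?_ hc
    · exact fun b hb => hG a ha b hb
    · exact Commute.zero_right _
    · exact fun _ _ _ _ => Commute.add_right
    · exact fun _ _ => Commute.neg_right
  have h2 : ∀ a ∈ AddSubgroup.closure G, ∀ c ∈ AddSubgroup.closure G, Commute a c := by
    intro a ha c hc
    refine AddSubgroup.closure_induction (p := fun a _ => Commute a c) ?_ ?_ ?_ ?_ ha
    · exact fun b hb => h1 b hb c hc
    · exact Commute.zero_left _
    · exact fun _ _ _ _ => Commute.add_left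
    · exact fun _ _ => Commute.neg_left
  intro c hcc
  refine AddSubgroup.closure_induction (p := fun c _ => c ^ p ^ n = c) hpow ?_ ?_ ?_ hcc
  · exact zero_pow (pow_ne_zero _ hp.ne_zero)
  · intro x y hx hy h h'
    rw [add_pow_p hp hc (h2 x hx y hy), h, h']
  · intro x _ h
    rw [neg_pow_p hp hc, h]

theorem periodic {R : Type*} [Ring R] {w : R} {M : ℕ} (hM : 2 ≤ M) (h : w ^ M = w) (i : ℕ) :
    ∃ l < M, 1 ≤ l ∧ w ^ (i + 1) = w ^ l := by
  induction i with
  | zero => exact ⟨1, by omega, le_rfl, by simp⟩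
  | succ i ih =>
    obtain ⟨l, h1, h2, h3⟩ := ih
    rw [pow_succ, h3, ← pow_succ]
    by_cases hl : l + 1 < M
    · exact ⟨l + 1, hl, by omega, rfl⟩
    · have : l + 1 = M := by omega
      exact ⟨1, by omega, le_rfl, by rw [this, h, pow_one]⟩

theorem idem {R : Type*} [Ring R] {w : R} {M : ℕ} (hM : 2 ≤ M) (h : w ^ M = w) :
    w ^ (M - 1) * w ^ (M - 1) = w ^ (M - 1) := by
  have : w ^ (M - 1) * w ^ (M - 1) = w ^ M * w ^ (M - 2) := by
    rw [← pow_add, ← pow_add]; congr 1; omega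
  rw [this, h, ← pow_succ']; congr 1; omega

theorem idem_mul {R : Type*} [Ring R] {w : R} {M : ℕ} (hM : 2 ≤ M) (h : w ^ M = w) :
    w ^ (M - 1) * w = w := by
  rw [← pow_succ, Nat.sub_add_cancel (by omega), h]

/-- the finite commutative ring generated by `w` -/
theorem gen_one {R : Type*} [Ring R] {p : ℕ} (hp : p.Prime) (hc : (p : R) = 0) (n : ℕ)
    (hM : 2 ≤ p ^ n) {w : R} (h : w ^ p ^ n = w) :
    ∃ T : NonUnitalSubring R, Finite T ∧ (∀ i, i ≠ 0 → w ^ i ∈ T) ∧ (∀ c ∈ T, c ^ p ^ n = c) ∧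
      ∀ A : AddSubgroup R, (∀ i, i ≠ 0 → w ^ i ∈ A) → ∀ c ∈ T, c ∈ A := by
  classical
  have hfin : (Set.range fun i : ℕ => w ^ (i + 1)).Finite := by
    refine Set.Finite.subset ((Finset.range (p ^ n)).image (w ^ ·)).finite_toSet ?_
    rintro _ ⟨i, rfl⟩
    obtain ⟨l, h1, h2, h3⟩ := periodic hM h i
    simp only [h3]
    exact Finset.mem_coe.2 (Finset.mem_image_of_mem _ (Finset.mem_range.2 h1))
  have hmul : ∀ a ∈ Set.range (fun i : ℕ => w ^ (i + 1)),
      ∀ b ∈ Set.range (fun i : ℕ => w ^ (i + 1)), a * b ∈ Set.range (fun i : ℕ => w ^ (i + 1)) := by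
    rintro _ ⟨i, rfl⟩ _ ⟨l, rfl⟩
    exact ⟨i + 1 + l, by rw [← pow_add]; congr 1⟩
  obtain ⟨T, hT, hTc⟩ := finite_closure hp.ne_zero hc _ hfin hmul
  have hmem : ∀ c, c ∈ T ↔ c ∈ AddSubgroup.closure (Set.range fun i : ℕ => w ^ (i + 1)) := by
    intro c
    rw [← SetLike.mem_coe, hTc, SetLike.mem_coe]
  refine ⟨T, hT, ?_, ?_, ?_⟩
  · intro i hi
    obtain ⟨i, rfl⟩ := Nat.exists_eq_succ_of_ne_zero hi
    exact (hmem _).2 (AddSubgroup.subset_closure ⟨i, rfl⟩)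
  · intro c hcT
    refine pow_sum_comm hp hc n _ ?_ ?_ c ((hmem c).1 hcT)
    · rintro _ ⟨i, rfl⟩ _ ⟨l, rfl⟩
      exact (Commute.refl w).pow_pow _ _
    · rintro _ ⟨i, rfl⟩
      simp only
      rw [← pow_mul, mul_comm, pow_mul, h]
  · intro A hA c hcT
    refine (AddSubgroup.closure_le A).2 ?_ ((hmem c).1 hcT)
    rintro _ ⟨i, rfl⟩
    exact hA _ (by omega)

namespace Good
variable {R V : Type*} [Ring R] [AddCommGroup V] {p j : ℕ} {S : AddSubgroup R} {L : R →+ V}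

theorem two_le_M (g : Good p j S L) : 2 ≤ p ^ (2 * j * (p ^ j).factorial) := by
  have := g.two_le_N
  rw [pow_mul]
  exact this.trans (Nat.le_self_pow (Nat.factorial_ne_zero _) _)

theorem regular (g : Good p j S L) {θ : R} (hθ : θ ∈ S) :
    ∃ r, (θ ^ p ^ (2 * j * r)) ^ p ^ (2 * j * (p ^ j).factorial) = θ ^ p ^ (2 * j * r) := by
  have h := g.algebraic hθ
  refine ⟨p ^ j * (p ^ j * p ^ (2 * j * p ^ j)), sub_eq_zero.1 ?_⟩
  rw [← pow_mul, mul_comm, pow_mul,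
    ← sub_pow_p g.prime g.char ((Commute.refl θ).pow_left _)]
  exact pow_eq_zero_of_le (g.le_pow _) h

theorem step3 (g : Good p j S L) {e y x : R} (hx : x ∈ S) (hey : e * y = y)
    (hye : y * e = 0) (hex : e * x = 0) (hxe : x * e = x) : L (y * x) = 0 := by
  have hwS : y * x ∈ S := g.mulL _ _ hx
  -- first reduce to the regular case
  suffices H : ∀ x ∈ S, e * x = 0 → x * e = x →
      (y * x) ^ p ^ (2 * j * (p ^ j).factorial) = y * x → L (y * x) = 0 by
    obtain ⟨r, hr⟩ := g.regular hwS
    have hpos : 0 < p ^ (2 * j * r) := pow_pos g.prime.pos _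
    have e1 : (y * x) ^ p ^ (2 * j * r) = y * (x * (y * x) ^ (p ^ (2 * j * r) - 1)) := by
      rw [← mul_assoc, ← pow_succ', Nat.sub_add_cancel hpos]
    rw [← g.hNr hwS r, e1]
    have hpe : (y * x) ^ (p ^ (2 * j * r) - 1) = 1 ∨
        (y * x) ^ (p ^ (2 * j * r) - 1) * e = (y * x) ^ (p ^ (2 * j * r) - 1) := by
      rcases Nat.eq_zero_or_pos (p ^ (2 * j * r) - 1) with h | h
      · left; rw [h, pow_zero]
      · right
        obtain ⟨m, hm⟩ := Nat.exists_eq_succ_of_ne_zero h.ne.symm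
        rw [hm, Nat.succ_eq_add_one, pow_succ, mul_assoc, mul_assoc, hxe]
    refine H _ (g.mulR _ _ hx) (by rw [← mul_assoc, hex, zero_mul]) ?_ (by rw [← e1, hr])
    rcases hpe with h | h
    · rw [h, mul_one, hxe]
    · rw [mul_assoc, h]
  intro x hx hex hxe hw
  have hwS : y * x ∈ S := g.mulL _ _ hx
  have hM := g.two_le_M
  by_contra hL
  obtain ⟨T, hTf, hTw, hTM, hTA⟩ := gen_one g.prime g.char _ hM hw
  have hw1 : y * x ∈ T := by simpa using hTw 1 one_ne_zero
  have hTS : ∀ c ∈ T, c ∈ S := hTA S fun i hi => g.pow_mem hwS hi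
  have hTe : ∀ c ∈ T, c * e = c := by
    intro c hc
    have := hTA (AddMonoidHom.ker (AddMonoidHom.mulRight e - AddMonoidHom.id R)) ?_ c hc
    · rw [AddMonoidHom.mem_ker] at this
      simpa [sub_eq_zero] using this
    · intro i hi
      obtain ⟨i, rfl⟩ := Nat.exists_eq_succ_of_ne_zero hi
      rw [AddMonoidHom.mem_ker]
      simp only [AddMonoidHom.sub_apply, AddMonoidHom.coe_mulRight, AddMonoidHom.id_apply]
      rw [Nat.succ_eq_add_one, pow_succ, mul_assoc, mul_assoc, hxe, sub_self]
  have hTe' : ∀ c ∈ T, e * c = c := by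
    intro c hc
    have := hTA (AddMonoidHom.ker (AddMonoidHom.mulLeft e - AddMonoidHom.id R)) ?_ c hc
    · rw [AddMonoidHom.mem_ker] at this
      simpa [sub_eq_zero] using this
    · intro i hi
      obtain ⟨i, rfl⟩ := Nat.exists_eq_succ_of_ne_zero hi
      rw [AddMonoidHom.mem_ker]
      simp only [AddMonoidHom.sub_apply, AddMonoidHom.coe_mulLeft, AddMonoidHom.id_apply]
      rw [Nat.succ_eq_add_one, pow_succ', ← mul_assoc, ← mul_assoc, hey, sub_self]
  obtain ⟨F, _, _, φ, hinj, hφT, hφs, hφc, c, hc, hPc⟩ := field_piece T _ hM hTM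
    (fun ε => ∃ c ∈ T, L (ε * c) ≠ 0) (by simp) (by
      rintro e he f hf - - ⟨c, hc, h⟩
      by_contra hcon
      push Not at hcon
      apply h
      rw [add_mul, map_add, hcon.1 c hc, hcon.2 c hc, add_zero])
    ⟨_, hTw _ (by omega), idem hM hw, y * x, hw1, by rwa [idem_mul hM hw]⟩
  obtain ⟨f0, hf0⟩ := hφs _ hw1
  have hf0' : f0 ≠ 0 := by
    rintro rfl
    rw [map_zero] at hf0
    have h1 := hTA (AddMonoidHom.ker (AddMonoidHom.mulLeft (φ 1))) ?_ c hc
    · rw [AddMonoidHom.mem_ker, AddMonoidHom.coe_mulLeft] at h1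
      exact hPc (by rw [h1, map_zero])
    · intro i hi
      obtain ⟨i, rfl⟩ := Nat.exists_eq_succ_of_ne_zero hi
      rw [AddMonoidHom.mem_ker, AddMonoidHom.coe_mulLeft, Nat.succ_eq_add_one, pow_succ',
        ← mul_assoc, ← hf0, zero_mul]
  have hz := g.mat2 φ hinj (fun f => hTS _ (hφT f)) (x * φ f0⁻¹) (φ 1 * y)
    (by
      rw [mul_assoc, ← mul_assoc y, ← mul_assoc, ← hf0, ← map_mul, mul_inv_cancel₀ hf0'])
    (by rw [← hTe _ (hφT 1), mul_assoc, ← mul_assoc e, hex, zero_mul, mul_zero])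
    (by rw [← hTe' _ (hφT 1)]
        calc e * φ 1 * y * (e * φ 1) = e * φ 1 * (y * e) * φ 1 := by simp only [mul_assoc]
          _ = 0 := by rw [hye]; simp)
    (by rw [← mul_assoc, ← map_mul, one_mul])
    (by rw [mul_assoc, ← map_mul, mul_one])
  obtain ⟨f, hf⟩ := hφs c hc
  exact hPc (by rw [← hf, hz])

end Good
end WnP


namespace WnP
namespace Good
variable {R V : Type*} [Ring R] [AddCommGroup V] {p j : ℕ} {S : AddSubgroup R} {L : R →+ V}

theorem peirce (g : Good p j S L) {e f y : R} (hef : e + f = 1) (hee : e * e = e) (hff : f * f = f)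
    (h1 : e * f = 0) (h2 : f * e = 0) (hS : ∀ q, f * q * e ∈ S) (hy : y ∈ S) (hey : e * y = y)
    (hyf : y * f = y) : y = 0 := by
  have hye : y * e = 0 := by rw [← hyf, mul_assoc, h2, mul_zero]
  have hfy : f * y = 0 := by rw [← hey, ← mul_assoc, h2, zero_mul]
  refine g.nondeg y hy fun u q => ?_
  have hm : u * y * q ∈ S := g.mulR _ _ (g.mulL _ _ hy)
  have t1 : L (e * (u * y * q) * e) = 0 := by
    have e1 : e * (u * y * q) * e = (e * u * y) * (f * q * e) := by
      calc e * (u * y * q) * e = e * u * y * q * e := by simp only [mul_assoc]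
        _ = e * u * (y * f) * q * e := by rw [hyf]
        _ = _ := by simp only [mul_assoc]
    rw [e1]
    refine g.step3 (e := e) (hS q) ?_ ?_ ?_ ?_
    · rw [← mul_assoc, ← mul_assoc, hee]
    · rw [mul_assoc, hye, mul_zero]
    · rw [← mul_assoc, ← mul_assoc, h1, zero_mul, zero_mul]
    · rw [mul_assoc, hee]
  have t2 : L (f * (u * y * q) * f) = 0 := by
    have e1 : f * (u * y * q) * f = (f * u * e) * (y * q * f) := by
      calc f * (u * y * q) * f = f * u * y * q * f := by simp only [mul_assoc]
        _ = f * u * (e * y) * q * f := by rw [hey]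
        _ = _ := by simp only [mul_assoc]
    rw [e1]
    refine g.step3 (e := f) (g.mulR _ _ (g.mulR _ _ hy)) ?_ ?_ ?_ ?_
    · rw [← mul_assoc, ← mul_assoc, hff]
    · rw [mul_assoc, h1, mul_zero]
    · rw [← mul_assoc, ← mul_assoc, hfy, zero_mul, zero_mul]
    · rw [mul_assoc, hff]
  have t3 : L (e * (u * y * q) * f) = 0 := by
    refine g.sqz (g.mulR _ _ (g.mulL _ _ hm)) ?_
    rw [mul_assoc, ← mul_assoc f, ← mul_assoc f, h2]; simp
  have t4 : L (f * (u * y * q) * e) = 0 := by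
    refine g.sqz (g.mulR _ _ (g.mulL _ _ hm)) ?_
    rw [mul_assoc, ← mul_assoc e, ← mul_assoc e, h1]; simp
  calc L (u * y * q) = L ((e + f) * (u * y * q) * (e + f)) := by rw [hef, one_mul, mul_one]
    _ = L (e * (u * y * q) * e) + L (f * (u * y * q) * e) + (L (e * (u * y * q) * f)
        + L (f * (u * y * q) * f)) := by
      rw [mul_add, add_mul, add_mul, add_mul, map_add, map_add, map_add]
    _ = 0 := by rw [t1, t2, t3, t4]; simp

theorem central (g : Good p j S L) {e : R} (he : e ∈ S) (hee : e * e = e) (r : R) :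
    e * r = r * e := by
  have h1 : e * (1 - e) = 0 := by rw [mul_sub, hee, mul_one, sub_self]
  have h2 : (1 - e) * e = 0 := by rw [sub_mul, hee, one_mul, sub_self]
  have hff : (1 - e) * (1 - e) = 1 - e := by rw [mul_sub, h2, mul_one, sub_zero]
  have a1 : e * r * (1 - e) = 0 := by
    refine g.peirce (e := e) (f := 1 - e) (by abel) hee hff h1 h2 (fun q => g.mulL _ _ he)
      (g.mulR _ _ (g.mulR _ _ he)) ?_ ?_
    · rw [← mul_assoc, ← mul_assoc, hee]
    · rw [mul_assoc, hff]
  have a2 : (1 - e) * r * e = 0 := by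
    refine g.peirce (e := 1 - e) (f := e) (by abel) hff hee h2 h1
      (fun q => g.mulR _ _ (g.mulR _ _ he)) (g.mulL _ _ he) ?_ ?_
    · rw [← mul_assoc, ← mul_assoc, hff]
    · rw [mul_assoc, hee]
  rw [mul_sub, mul_one, sub_eq_zero] at a1
  rw [sub_mul, one_mul, sub_mul, sub_eq_zero] at a2
  rw [a1, a2]

theorem reduced2 (g : Good p j S L) {z : R} (hz : z ∈ S) (hzz : z * z = 0) : z = 0 := by
  refine g.eq_zero_of_nil hz fun x => ?_
  have hwS : z * x ∈ S := g.mulR _ _ hz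
  obtain ⟨r, hr⟩ := g.regular hwS
  refine ⟨p ^ (2 * j * r), ?_⟩
  have hM := g.two_le_M
  have hpos : p ^ (2 * j * r) ≠ 0 := pow_ne_zero _ g.prime.ne_zero
  set w := (z * x) ^ p ^ (2 * j * r) with hw
  have hwS' : w ∈ S := g.pow_mem hwS hpos
  have hcen := g.central (g.pow_mem hwS' (by omega)) (idem hM hr)
  have hzw : z * w = 0 := by
    obtain ⟨m, hm⟩ := Nat.exists_eq_succ_of_ne_zero hpos
    rw [hw, hm, Nat.succ_eq_add_one, pow_succ', ← mul_assoc, ← mul_assoc, hzz]; simp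
  have hze : z * w ^ (p ^ (2 * j * (p ^ j).factorial) - 1) = 0 := by
    obtain ⟨m, hm⟩ := Nat.exists_eq_succ_of_ne_zero
      (show p ^ (2 * j * (p ^ j).factorial) - 1 ≠ 0 by omega)
    rw [hm, Nat.succ_eq_add_one, pow_succ', ← mul_assoc, hzw, zero_mul]
  have h1 := idem_mul hM hr
  have h2 : ∃ h, w = z * h := by
    obtain ⟨m, hm⟩ := Nat.exists_eq_succ_of_ne_zero hpos
    exact ⟨_, by rw [hw, hm, Nat.succ_eq_add_one, pow_succ', mul_assoc]⟩
  obtain ⟨h, hh⟩ := h2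
  rw [← h1]
  nth_rewrite 2 [hh]
  rw [← mul_assoc, hcen z, hze, zero_mul]

theorem reduced (g : Good p j S L) {z : R} (hz : z ∈ S) (hn : IsNilpotent z) : z = 0 := by
  have H : ∀ n : ℕ, z ^ 2 ^ n = 0 → z = 0 := by
    intro n
    induction n with
    | zero => simp
    | succ n ih =>
      intro h
      exact ih (g.reduced2 (g.pow_mem hz (by positivity)) (by rw [← pow_add, ← h]; congr 1; ring))
  obtain ⟨n, hn⟩ := hn
  exact H n (pow_eq_zero_of_le (Nat.lt_two_pow_self).le hn)

theorem potent (g : Good p j S L) {a : R} (ha : a ∈ S) :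
    a ^ p ^ (2 * j * (p ^ j).factorial) = a := by
  refine sub_eq_zero.1 (g.reduced (S.sub_mem (g.pow_mem ha ?_) ha) ⟨_, g.algebraic ha⟩)
  exact pow_ne_zero _ g.prime.ne_zero

end Good
end WnP


namespace WnP

/-- `Σ φ(cᵢ) b aⁱ` -/
noncomputable def Phi {F R : Type*} [Field F] [Ring R] (φ : F →ₙ+* R) (a b : R) :
    Polynomial F →+ R where
  toFun f := f.sum fun i c => φ c * b * a ^ i
  map_zero' := by simp
  map_add' f h := by
    refine Polynomial.sum_add_index f h _ ?_ ?_
    · intro i; simp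
    · intro i c d; simp [add_mul]

theorem Phi_mono {F R : Type*} [Field F] [Ring R] (φ : F →ₙ+* R) (a b : R) (i : ℕ) (c : F) :
    Phi φ a b (Polynomial.monomial i c) = φ c * b * a ^ i :=
  Polynomial.sum_monomial_index (n := i) c (fun i c => φ c * b * a ^ i) (by simp)

theorem Phi_X {F R : Type*} [Field F] [Ring R] (φ : F →ₙ+* R) (a b : R) (f : Polynomial F) :
    Phi φ a b (Polynomial.X * f) = Phi φ a b f * a := by
  induction f using Polynomial.induction_on' with
  | add f h hf hh => rw [mul_add, map_add, hf, hh, map_add, add_mul]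
  | monomial n c =>
    rw [Polynomial.X_mul_monomial, Phi_mono, Phi_mono, pow_succ, ← mul_assoc]

theorem Phi_C {F R : Type*} [Field F] [Ring R] (φ : F →ₙ+* R) (a b : R) (β : F)
    (f : Polynomial F) :
    Phi φ a b (Polynomial.C β * f) = φ β * Phi φ a b f := by
  induction f using Polynomial.induction_on' with
  | add f h hf hh => rw [mul_add, map_add, hf, hh, map_add, mul_add]
  | monomial n c =>
    rw [Polynomial.C_mul_monomial, Phi_mono, Phi_mono, map_mul, mul_assoc, mul_assoc, mul_assoc]

theorem eigen {F R : Type*} [Field F] [Finite F] [Ring R] (φ : F →ₙ+* R) (b : R) (α : F)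
    (h : φ 1 * b = b) (hne : φ α * b - b * φ α ≠ 0) :
    ∃ (f : Polynomial F) (β : F), β ≠ α ∧ Phi φ (φ α) b f ≠ 0 ∧
      Phi φ (φ α) b f * φ α = φ β * Phi φ (φ α) b f := by
  classical
  have := Fintype.ofFinite F
  by_contra hcon
  push Not at hcon
  have hq : 1 < Fintype.card F := Fintype.one_lt_card
  have key : ∀ s : Finset F, α ∉ s → Phi φ (φ α) b
      ((∏ β ∈ s, (Polynomial.X - Polynomial.C β)) * (Polynomial.X - Polynomial.C α)) ≠ 0 := by
    intro s
    induction s using Finset.induction_on with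
    | empty =>
      intro _ h0
      apply hne
      have e1 : (Polynomial.X - Polynomial.C α : Polynomial F) =
          Polynomial.monomial 1 1 - Polynomial.monomial 0 α := by
        rw [Polynomial.monomial_zero_left, Polynomial.monomial_one_one_eq_X]
      rw [Finset.prod_empty, one_mul, e1, map_sub, Phi_mono, Phi_mono, h] at h0
      rw [← neg_sub, neg_eq_zero]
      simpa using h0
    | insert β s hβ ih =>
      intro hα h0
      rw [Finset.mem_insert, not_or] at hα
      refine hcon _ β (fun h => hα.1 h.symm) (ih hα.2) ?_
      rw [Finset.prod_insert hβ, mul_assoc, sub_mul, map_sub, Phi_X, Phi_C, sub_eq_zero] at h0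
      exact h0
  refine key (Finset.univ.erase α) (by simp) ?_
  have hprod : ∏ β : F, (Polynomial.X - Polynomial.C β) =
      (Polynomial.X ^ Fintype.card F - Polynomial.X : Polynomial F) := by
    have hr := FiniteField.roots_X_pow_card_sub_X F
    have := Polynomial.prod_multiset_X_sub_C_of_monic_of_roots_card_eq
      (p := (Polynomial.X ^ Fintype.card F - Polynomial.X : Polynomial F))
      (Polynomial.monic_X_pow_sub (by rw [Polynomial.degree_X]; exact_mod_cast hq))
      (by rw [hr, FiniteField.X_pow_card_sub_X_natDegree_eq F hq]; rfl)
    rw [hr] at this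
    exact this
  rw [Finset.prod_erase_mul _ _ (Finset.mem_univ α), hprod]
  have e1 : (Polynomial.X ^ Fintype.card F - Polynomial.X : Polynomial F) =
      Polynomial.monomial (Fintype.card F) 1 - Polynomial.monomial 1 1 := by
    rw [Polynomial.monomial_one_one_eq_X, Polynomial.monomial_one_right_eq_X_pow]
  rw [e1, map_sub, Phi_mono, Phi_mono, h, ← map_pow_nu φ α (by omega), FiniteField.pow_card,
    pow_one, sub_self]

theorem nu_pow_mem {R : Type*} [Ring R] (T : NonUnitalSubring R) {z : R} (hz : z ∈ T) {n : ℕ}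
    (hn : n ≠ 0) : z ^ n ∈ T := by
  obtain ⟨m, rfl⟩ := Nat.exists_eq_succ_of_ne_zero hn
  induction m with
  | zero => simpa using hz
  | succ m ih => rw [Nat.succ_eq_add_one, pow_succ]; exact T.mul_mem (ih (by omega)) hz

namespace Good
variable {R V : Type*} [Ring R] [AddCommGroup V] {p j : ℕ} {S : AddSubgroup R} {L : R →+ V}

theorem Phi_mem (g : Good p j S L) {F : Type*} [Field F] (φ : F →ₙ+* R) (a b : R) (hb : b ∈ S)
    (f : Polynomial F) : Phi φ a b f ∈ S :=
  S.sum_mem fun _ _ => g.mulR _ _ (g.mulL _ _ hb)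

theorem fin_comm (g : Good p j S L) (T : NonUnitalSubring R) [Finite T] (hTS : ∀ c ∈ T, c ∈ S)
    {a x : R} (ha : a ∈ T) (hx : x ∈ T) : a * x = x * a := by
  by_contra hne
  have hM := g.two_le_M
  have hz : a * x - x * a ∈ T := T.sub_mem (T.mul_mem ha hx) (T.mul_mem hx ha)
  have hzM := g.potent (hTS _ hz)
  obtain ⟨F, _, _, φ, hinj, hφT, hφs, hφc, hP⟩ := field_piece T _ hM
    (fun c hc => g.potent (hTS c hc)) (fun e => e * (a * x - x * a) ≠ 0) (by simp) (by
      intro e _ f _ _ _ h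
      by_contra hcon
      push Not at hcon
      exact h (by rw [add_mul, hcon.1, hcon.2, add_zero]))
    ⟨_, nu_pow_mem T hz (n := p ^ (2 * j * (p ^ j).factorial) - 1) (by omega), idem hM hzM, by
      rw [idem_mul hM hzM]; exact sub_ne_zero.2 hne⟩
  obtain ⟨f1, h1⟩ := hφs a ha
  obtain ⟨f2, h2⟩ := hφs x hx
  apply hP
  have h11 : φ 1 * φ 1 = φ 1 := by rw [← map_mul, one_mul]
  have e1 : φ 1 * (a * x) = φ f1 * φ f2 := by
    rw [h1, h2, hφc a ha, mul_assoc a, ← mul_assoc (φ 1) (φ 1), h11, ← mul_assoc a, ← hφc a ha,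
      mul_assoc]
  have e2 : φ 1 * (x * a) = φ f2 * φ f1 := by
    rw [h1, h2, hφc x hx, mul_assoc x, ← mul_assoc (φ 1) (φ 1), h11, ← mul_assoc x, ← hφc x hx,
      mul_assoc]
  rw [mul_sub, e1, e2, ← map_mul, ← map_mul, mul_comm, sub_self]

theorem commutative (g : Good p j S L) {a b : R} (ha : a ∈ S) (hb : b ∈ S) : a * b = b * a := by
  by_contra hne
  have hM := g.two_le_M
  have haM := g.potent ha
  obtain ⟨T, hTf, hTw, hTM, hTA⟩ := gen_one g.prime g.char _ hM haM
  have haT : a ∈ T := by simpa using hTw 1 one_ne_zero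
  have hTS : ∀ c ∈ T, c ∈ S := hTA S fun i hi => g.pow_mem ha hi
  obtain ⟨F, _, _, φ, hinj, hφT, hφs, hφc, hP⟩ := field_piece T _ hM hTM
    (fun e => e * (a * b - b * a) ≠ 0) (by simp) (by
      intro e _ f _ _ _ h
      by_contra hcon
      push Not at hcon
      exact h (by rw [add_mul, hcon.1, hcon.2, add_zero]))
    ⟨_, hTw (p ^ (2 * j * (p ^ j).factorial) - 1) (by omega), idem hM haM, by
      rw [mul_sub, ← mul_assoc, idem_mul hM haM, ← mul_assoc,
        g.central (g.pow_mem ha (by omega)) (idem hM haM) b, mul_assoc, idem_mul hM haM]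
      exact sub_ne_zero.2 hne⟩
  have h11 : φ 1 * φ 1 = φ 1 := by rw [← map_mul, one_mul]
  have hcen := g.central (hTS _ (hφT 1)) h11
  obtain ⟨α, hα⟩ := hφs a haT
  obtain ⟨f, β, hβ, hx0, hxβ⟩ := eigen φ (φ 1 * b) α (by rw [← mul_assoc, h11]) (by
    rw [hα]
    have e1 : φ 1 * a * (φ 1 * b) = φ 1 * (a * b) := by
      rw [mul_assoc, ← mul_assoc a, ← hcen a, mul_assoc, ← mul_assoc, h11]
    have e2 : φ 1 * b * (φ 1 * a) = φ 1 * (b * a) := by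
      rw [mul_assoc, ← mul_assoc b, ← hcen b, mul_assoc, ← mul_assoc, h11]
    rw [e1, e2, ← mul_sub]; exact hP)
  have hxS := g.Phi_mem φ (φ α) (φ 1 * b) (g.mulL _ _ hb) f
  have hx1 : φ 1 * Phi φ (φ α) (φ 1 * b) f = Phi φ (φ α) (φ 1 * b) f := by
    rw [← Phi_C, Polynomial.C_1, one_mul]
  set x := Phi φ (φ α) (φ 1 * b) f
  have hxM := g.potent hxS
  -- x normalises the field
  have hnorm : ∀ c : F, ∃ d : F, x * φ c = φ d * x := by
    let A : AddSubgroup R :=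
      { carrier := {c | ∃ d : F, x * (φ 1 * c) = φ d * x}
        zero_mem' := ⟨0, by simp⟩
        add_mem' := by
          rintro c c' ⟨d, hd⟩ ⟨d', hd'⟩
          exact ⟨d + d', by rw [mul_add, mul_add, hd, hd', map_add, add_mul]⟩
        neg_mem' := by
          rintro c ⟨d, hd⟩
          exact ⟨-d, by rw [mul_neg, mul_neg, hd, map_neg, neg_mul]⟩ }
    intro c
    have := hTA A ?_ _ (hφT c)
    · obtain ⟨d, hd⟩ := this
      exact ⟨d, by rw [← hd, ← map_mul, one_mul]⟩
    · intro i hi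
      obtain ⟨i, rfl⟩ := Nat.exists_eq_succ_of_ne_zero hi
      refine ⟨β ^ (i + 1), ?_⟩
      induction i with
      | zero => rw [zero_add, pow_one, pow_one, ← hα, hxβ]
      | succ i ih =>
        rw [Nat.succ_eq_add_one, pow_succ, ← mul_assoc, ← mul_assoc]
        rw [← mul_assoc] at ih
        have hxa : x * a = φ β * x := by
          rw [← hxβ, hα, ← mul_assoc, ← hcen x, hx1]
        have := ih (by omega)
        rw [Nat.succ_eq_add_one] at this
        rw [this, mul_assoc, hxa, ← mul_assoc, ← map_mul, ← pow_succ]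
  have hnormi : ∀ (i : ℕ) (c : F), ∃ d : F, x ^ i * φ c = φ d * x ^ i := by
    intro i
    induction i with
    | zero => exact fun c => ⟨c, by simp⟩
    | succ i ih =>
      intro c
      obtain ⟨d, hd⟩ := hnorm c
      obtain ⟨d', hd'⟩ := ih d
      exact ⟨d', by rw [pow_succ, mul_assoc, hd, ← mul_assoc, hd', mul_assoc]⟩
  let G : Set R := Set.range fun q : F × ℕ => φ q.1 * x ^ q.2
  have hGfin : G.Finite := by
    refine Set.Finite.subset (Set.finite_range fun q : F × Fin (p ^ (2 * j * (p ^ j).factorial)) =>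
      φ q.1 * x ^ (q.2 : ℕ)) ?_
    rintro _ ⟨⟨c, i⟩, rfl⟩
    rcases i with _ | i
    · exact ⟨⟨c, ⟨0, by omega⟩⟩, rfl⟩
    · obtain ⟨l, h1, _, h3⟩ := periodic hM hxM i
      exact ⟨⟨c, ⟨l, h1⟩⟩, by simp only [h3]⟩
  have hGmul : ∀ a ∈ G, ∀ b ∈ G, a * b ∈ G := by
    rintro _ ⟨⟨c, i⟩, rfl⟩ _ ⟨⟨c', i'⟩, rfl⟩
    obtain ⟨d, hd⟩ := hnormi i c'
    refine ⟨⟨c * d, i + i'⟩, ?_⟩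
    simp only
    rw [mul_assoc, ← mul_assoc (x ^ i), hd, map_mul, pow_add]
    simp only [mul_assoc]
  obtain ⟨T2, hT2, hT2c⟩ := finite_closure g.prime.ne_zero g.char G hGfin hGmul
  have hmem : ∀ c, c ∈ T2 ↔ c ∈ AddSubgroup.closure G := by
    intro c
    rw [← SetLike.mem_coe, hT2c, SetLike.mem_coe]
  have hT2S : ∀ c ∈ T2, c ∈ S := by
    intro c hc
    refine (AddSubgroup.closure_le S).2 ?_ ((hmem c).1 hc)
    rintro _ ⟨⟨c, i⟩, rfl⟩
    exact g.mulR _ _ (hTS _ (hφT c))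
  have hcm := g.fin_comm T2 hT2S (a := φ α) (x := x)
    ((hmem _).2 (AddSubgroup.subset_closure ⟨⟨α, 0⟩, by simp⟩))
    ((hmem _).2 (AddSubgroup.subset_closure ⟨⟨1, 1⟩, by simpa using hx1⟩))
  apply hx0
  have h0 : φ (α - β) * x = 0 := by rw [map_sub, sub_mul, hcm, hxβ, sub_self]
  rw [← hx1, ← inv_mul_cancel₀ (sub_ne_zero.2 hβ.symm), map_mul, mul_assoc, h0, mul_zero]

theorem final (g : Good p j S L) {a : R} (ha : a ∈ S) : a ^ p ^ (2 * j) = a := by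
  have hne : p ^ (2 * j) ≠ 0 := pow_ne_zero _ g.prime.ne_zero
  refine sub_eq_zero.1 (g.nondegS (S.sub_mem (g.pow_mem ha hne) ha) fun x hx y hy => ?_)
  have e1 : ∀ c ∈ S, x * c * y = (x * y) * c := by
    intro c hc
    rw [mul_assoc, g.commutative hc hy, mul_assoc]
  rw [mul_sub, sub_mul, e1 _ (g.pow_mem ha hne), e1 _ ha, map_sub,
    g.comm (g.mulL _ _ hy) ha (g.commutative (g.mulL _ _ hy) ha), sub_self]

end Good
end WnP


namespace WnP
namespace Good
variable {R V : Type*} [Ring R] [AddCommGroup V] {p j : ℕ} {S : AddSubgroup R} {L : R →+ V}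

theorem gen_mul (g : Good p j S L) {u v c d : R} (hu : u ∈ S) (hv : v ∈ S)
    (hc : c = u + u ^ p ^ j ∨ c = u ^ (p ^ j + 1)) (hd : d = v + v ^ p ^ j ∨ d = v ^ (p ^ j + 1)) :
    L (c * d) = 0 := by
  have hpp : ∀ a ∈ S, (a ^ p ^ j) ^ p ^ j = a := by
    intro a ha
    rw [← pow_mul, ← pow_add, ← two_mul, g.final ha]
  have ht : ∀ t ∈ S, L (t + t ^ p ^ j) = 0 := by
    intro t ht
    rw [map_add, g.hQ t ht, add_neg_cancel]
  have hsum : ∀ a ∈ S, a + a ^ p ^ j ∈ S := fun a ha => S.add_mem ha (g.pow_mem ha g.Qne)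
  have key : ∀ u ∈ S, ∀ v ∈ S, L ((u + u ^ p ^ j) * v ^ (p ^ j + 1)) = 0 := by
    intro u hu v hv
    have hvS : v ^ (p ^ j + 1) ∈ S := g.pow_mem hv (by omega)
    have e1 : (u * v ^ (p ^ j + 1)) ^ p ^ j = u ^ p ^ j * v ^ (p ^ j + 1) := by
      rw [(show Commute u (v ^ (p ^ j + 1)) from g.commutative hu hvS).mul_pow]
      congr 1
      rw [← pow_mul, mul_comm, pow_mul, pow_succ, hpp v hv, ← pow_succ']
    rw [add_mul, ← e1]
    exact ht _ (g.mulR _ _ hu)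
  rcases hc with rfl | rfl <;> rcases hd with rfl | rfl
  · have e1 : (u * (v + v ^ p ^ j)) ^ p ^ j = u ^ p ^ j * (v + v ^ p ^ j) := by
      rw [(show Commute u (v + v ^ p ^ j) from g.commutative hu (hsum v hv)).mul_pow,
        add_pow_p g.prime g.char ((Commute.refl v).pow_right _), hpp v hv, add_comm v]
    rw [add_mul, ← e1]
    exact ht _ (g.mulR _ _ hu)
  · exact key u hu v hv
  · rw [g.commutative (g.pow_mem hu (by omega)) (hsum v hv)]
    exact key v hv u hu
  · rw [← (show Commute u v from g.commutative hu hv).mul_pow]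
    exact g.hQ1 _ (g.mulR _ _ hu)

end Good

theorem core {A : Type*} [Ring A] {p j : ℕ} (hp : p.Prime) (hj : 1 ≤ j) (hc : (p : A) = 0)
    (S W : AddSubgroup A) (hl : ∀ r s : A, s ∈ S → r * s ∈ S) (hr : ∀ s r : A, s ∈ S → s * r ∈ S)
    (h1 : ∀ u ∈ S, u + u ^ p ^ j ∈ W) (h2 : ∀ u ∈ S, u ^ (p ^ j + 1) ∈ W)
    {u v c d : A} (hu : u ∈ S) (hv : v ∈ S)
    (hcu : c = u + u ^ p ^ j ∨ c = u ^ (p ^ j + 1))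
    (hd : d = v + v ^ p ^ j ∨ d = v ^ (p ^ j + 1)) : c * d ∈ W := by
  let J : Ideal A :=
    { carrier := {a | ∀ x y, x * a * y ∈ W}
      zero_mem' := fun x y => by simp
      add_mem' := fun ha hb x y => by rw [mul_add, add_mul]; exact W.add_mem (ha x y) (hb x y)
      smul_mem' := fun r a ha x y => by
        rw [smul_eq_mul, ← mul_assoc]; exact ha _ _ }
  have hJ : ∀ a, a ∈ J ↔ ∀ x y, x * a * y ∈ W := fun a => Iff.rfl
  have : J.IsTwoSided := ⟨fun b ha x y => by
    have := ha x (b * y)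
    simpa only [mul_assoc] using this⟩
  let π : A →+* A ⧸ J := Ideal.Quotient.mk J
  have hπ : Function.Surjective π := Ideal.Quotient.mk_surjective
  have hπ0 : ∀ a, π a = 0 ↔ a ∈ J := fun a => Ideal.Quotient.eq_zero_iff_mem
  have hker : π.toAddMonoidHom.ker ≤ (QuotientAddGroup.mk' W).ker := by
    intro a ha
    rw [AddMonoidHom.mem_ker] at ha
    have := (hJ a).1 ((hπ0 a).1 ha) 1 1
    rw [one_mul, mul_one] at this
    rw [QuotientAddGroup.ker_mk']
    exact this
  let L : A ⧸ J →+ A ⧸ W :=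
    AddMonoidHom.liftOfSurjective π.toAddMonoidHom hπ ⟨QuotientAddGroup.mk' W, hker⟩
  have hL : ∀ a, L (π a) = 0 ↔ a ∈ W := by
    intro a
    have : L (π a) = QuotientAddGroup.mk' W a :=
      AddMonoidHom.liftOfRightInverse_comp_apply π.toAddMonoidHom _ _
        ⟨QuotientAddGroup.mk' W, hker⟩ a
    rw [this]
    exact QuotientAddGroup.eq_zero_iff a
  have g : Good p j (S.map π.toAddMonoidHom) L :=
    { prime := hp
      jpos := hj
      char := by rw [← map_natCast π, hc, map_zero]
      mulL := by
        rintro r _ ⟨s, hs, rfl⟩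
        obtain ⟨r, rfl⟩ := hπ r
        exact ⟨r * s, hl _ _ hs, map_mul π _ _⟩
      mulR := by
        rintro _ r ⟨s, hs, rfl⟩
        obtain ⟨r, rfl⟩ := hπ r
        exact ⟨s * r, hr _ _ hs, map_mul π _ _⟩
      hQ := by
        rintro _ ⟨s, hs, rfl⟩
        have := (hL _).2 (h1 s hs)
        rw [map_add, map_add, map_pow, add_comm] at this
        exact eq_neg_of_add_eq_zero_left this
      hQ1 := by
        rintro _ ⟨s, hs, rfl⟩
        have := (hL _).2 (h2 s hs)
        rw [map_pow] at this
        exact this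
      nondeg := by
        rintro _ ⟨s, hs, rfl⟩ h
        refine (hπ0 s).2 ((hJ s).2 fun x y => (hL _).1 ?_)
        rw [map_mul π, map_mul π]
        exact h _ _ }
  rw [← hL, map_mul π]
  refine g.gen_mul (u := π u) (v := π v) ⟨u, hu, rfl⟩ ⟨v, hv, rfl⟩ ?_ ?_
  · rcases hcu with rfl | rfl
    · left; rw [map_add, map_pow]
    · right; rw [map_pow]
  · rcases hd with rfl | rfl
    · left; rw [map_add, map_pow]
    · right; rw [map_pow]

end WnP


namespace WnP

theorem aug_mulL {k : Type*} [Field k] {X : Type*} (r s : FreeAlgebra k X) (hs : s ∈ AugF k X) :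
    r * s ∈ AugF k X := by
  unfold AugF at *
  rw [LinearMap.mem_ker, AlgHom.toLinearMap_apply] at *
  rw [map_mul, hs, mul_zero]

theorem aug_mulR {k : Type*} [Field k] {X : Type*} (s r : FreeAlgebra k X) (hs : s ∈ AugF k X) :
    s * r ∈ AugF k X := by
  unfold AugF at *
  rw [LinearMap.mem_ker, AlgHom.toLinearMap_apply] at *
  rw [map_mul, hs, zero_mul]

theorem aug_pow {k : Type*} [Field k] {X : Type*} {s : FreeAlgebra k X} (hs : s ∈ AugF k X)
    {n : ℕ} (hn : n ≠ 0) : s ^ n ∈ AugF k X := by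
  obtain ⟨m, rfl⟩ := Nat.exists_eq_succ_of_ne_zero hn
  rw [Nat.succ_eq_add_one, pow_succ]; exact aug_mulL _ _ hs

theorem aug_ι {k : Type*} [Field k] {X : Type*} (x : X) : FreeAlgebra.ι k x ∈ AugF k X := by
  unfold AugF
  rw [LinearMap.mem_ker, AlgHom.toLinearMap_apply, FreeAlgebra.lift_ι_apply]

theorem aug_lift {k : Type*} [Field k] {X : Type*} (h : X → FreeAlgebra k X)
    (hh : ∀ x, h x ∈ AugF k X) {a : FreeAlgebra k X} (ha : a ∈ AugF k X) :
    FreeAlgebra.lift k h a ∈ AugF k X := by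
  unfold AugF at *
  simp only [LinearMap.mem_ker, AlgHom.toLinearMap_apply] at *
  have : (FreeAlgebra.lift k (fun _ : X => (0 : k))).comp (FreeAlgebra.lift k h) =
      FreeAlgebra.lift k (fun _ : X => (0 : k)) := by
    ext x
    simp [hh]
  rw [← AlgHom.comp_apply, this, ha]

/-- the T-space generated by a one-variable polynomial -/
theorem tsp_le {k : Type*} [Field k] {X : Type*} (x : X) (P : FreeAlgebra k X → FreeAlgebra k X)
    (hPm : ∀ (σ : FreeAlgebra k X →ₐ[k] FreeAlgebra k X) u, σ (P u) = P (σ u))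
    (hPa : ∀ u ∈ AugF k X, P u ∈ AugF k X) :
    TSpF k X {P (FreeAlgebra.ι k x)} ≤ Submodule.span k (P '' (AugF k X)) := by
  refine sInf_le ⟨⟨?_, ?_⟩, ?_⟩
  · rw [Submodule.span_le]
    rintro _ ⟨u, hu, rfl⟩
    exact hPa u hu
  · intro h hh v hv
    induction hv using Submodule.span_induction with
    | mem v hv =>
      obtain ⟨u, hu, rfl⟩ := hv
      exact Submodule.subset_span ⟨_, aug_lift h hh hu, (hPm _ _).symm⟩
    | zero => rw [map_zero]; exact Submodule.zero_mem _
    | add a b _ _ ha hb => rw [map_add]; exact Submodule.add_mem _ ha hb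
    | smul c a _ ha => rw [map_smul]; exact Submodule.smul_mem _ _ ha
  · rintro _ rfl
    exact Submodule.subset_span ⟨_, aug_ι x, rfl⟩

theorem mem_tsp {k : Type*} [Field k] {X : Type*} (x : X) (P : FreeAlgebra k X → FreeAlgebra k X)
    (hPm : ∀ (σ : FreeAlgebra k X →ₐ[k] FreeAlgebra k X) u, σ (P u) = P (σ u))
    {u : FreeAlgebra k X} (hu : u ∈ AugF k X) : P u ∈ TSpF k X {P (FreeAlgebra.ι k x)} := by
  unfold TSpF
  rw [Submodule.mem_sInf]
  rintro V ⟨hV, hP⟩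
  have := hV.2 (fun _ => u) (fun _ => hu) _ (hP rfl)
  rwa [hPm, FreeAlgebra.lift_ι_apply] at this

end WnP

/-- For each `n ≥ 1`, `W_{n,X}` is closed under multiplication, i.e. it is a
non-unital subalgebra of `k⟨X⟩₀`. -/
theorem WnF_mul_mem (x : X) (n : ℕ) (hn : 1 ≤ n)
    (a b : FreeAlgebra k X) (ha : a ∈ WnF k X x n) (hb : b ∈ WnF k X x n) :
    a * b ∈ WnF k X x n := by
  obtain ⟨p, hchar, m, hp, hcard⟩ := FiniteField.card' k
  have hQ : Fintype.card k ^ n = p ^ ((m : ℕ) * n) := by rw [hcard, pow_mul]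
  have hj : 1 ≤ (m : ℕ) * n := Nat.mul_pos m.pos hn
  have hc : ((p : ℕ) : FreeAlgebra k X) = 0 := by
    rw [← map_natCast (algebraMap k (FreeAlgebra k X)), CharP.cast_eq_zero, map_zero]
  let P1 : FreeAlgebra k X → FreeAlgebra k X := fun u => u + u ^ (Fintype.card k ^ n)
  let P2 : FreeAlgebra k X → FreeAlgebra k X := fun u => u ^ (Fintype.card k ^ n + 1)
  have m1 : ∀ (σ : FreeAlgebra k X →ₐ[k] FreeAlgebra k X) u, σ (P1 u) = P1 (σ u) := by
    intro σ u; simp [P1]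
  have m2 : ∀ (σ : FreeAlgebra k X →ₐ[k] FreeAlgebra k X) u, σ (P2 u) = P2 (σ u) := by
    intro σ u; simp [P2]
  have hQ0 : Fintype.card k ^ n ≠ 0 := by rw [hQ]; exact pow_ne_zero _ hp.ne_zero
  have a1 : ∀ u ∈ AugF k X, P1 u ∈ AugF k X := fun u hu =>
    Submodule.add_mem _ hu (WnP.aug_pow hu hQ0)
  have a2 : ∀ u ∈ AugF k X, P2 u ∈ AugF k X := fun u hu => WnP.aug_pow hu (by omega)
  have w1 : ∀ u ∈ AugF k X, P1 u ∈ WnF k X x n := fun u hu =>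
    Submodule.mem_sup_left (WnP.mem_tsp x P1 m1 hu)
  have w2 : ∀ u ∈ AugF k X, P2 u ∈ WnF k X x n := fun u hu =>
    Submodule.mem_sup_right (WnP.mem_tsp x P2 m2 hu)
  have hle : WnF k X x n ≤ Submodule.span k {c | ∃ u ∈ AugF k X, c = P1 u ∨ c = P2 u} := by
    refine sup_le ((WnP.tsp_le x P1 m1 a1).trans (Submodule.span_mono ?_))
      ((WnP.tsp_le x P2 m2 a2).trans (Submodule.span_mono ?_))
    · rintro _ ⟨u, hu, rfl⟩
      exact ⟨u, hu, Or.inl rfl⟩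
    · rintro _ ⟨u, hu, rfl⟩
      exact ⟨u, hu, Or.inr rfl⟩
  have key : ∀ u ∈ AugF k X, ∀ v ∈ AugF k X, ∀ c d, (c = P1 u ∨ c = P2 u) →
      (d = P1 v ∨ d = P2 v) → c * d ∈ WnF k X x n := by
    intro u hu v hv c d h1 h2
    simp only [P1, P2, hQ] at h1 h2 w1 w2
    exact WnP.core hp hj hc (AugF k X).toAddSubgroup (WnF k X x n).toAddSubgroup
      WnP.aug_mulL WnP.aug_mulR w1 w2 (u := u) (v := v) hu hv h1 h2
  have step : ∀ c ∈ Submodule.span k {c | ∃ u ∈ AugF k X, c = P1 u ∨ c = P2 u},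
      ∀ d ∈ Submodule.span k {c | ∃ u ∈ AugF k X, c = P1 u ∨ c = P2 u},
      c * d ∈ WnF k X x n := by
    intro c hcm d hdm
    induction hcm using Submodule.span_induction with
    | mem c hcm =>
      obtain ⟨u, hu, h1⟩ := hcm
      induction hdm using Submodule.span_induction with
      | mem d hdm =>
        obtain ⟨v, hv, h2⟩ := hdm
        exact key u hu v hv c d h1 h2
      | zero => rw [mul_zero]; exact Submodule.zero_mem _
      | add a b _ _ ha hb => rw [mul_add]; exact Submodule.add_mem _ ha hb
      | smul r a _ ha => rw [mul_smul_comm]; exact Submodule.smul_mem _ _ ha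
    | zero => rw [zero_mul]; exact Submodule.zero_mem _
    | add a b _ _ ha hb => rw [add_mul]; exact Submodule.add_mem _ ha hb
    | smul r a _ ha => rw [smul_mul_assoc]; exact Submodule.smul_mem _ _ ha
  exact step a (hle ha) b (hle hb)
end

section
/- For each n ≥ 1, k[x]₀ is the internal direct sum of Y_n and W_n; that is, Y_n + W_n = k[x]₀ and Y_n ∩ W_n = {0}. Moreover, the set {x^{i + q^n j} : q^n > i > j ≥ 0} is a k-linear basis of Y_n, so Y_n has dimension q^n(q^n−1)/2. -/
open Polynomial

variable (k : Type*) [Field k] [Fintype k]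

/-- `k[x]₀`: the free non-unital associative `k`-algebra on one generator `x`,
identified with the polynomials over `k` with zero constant term,
viewed as a `k`-submodule of `Polynomial k`. -/
noncomputable def A0 : Submodule k (Polynomial k) :=
  LinearMap.ker (Polynomial.aeval (0 : k)).toLinearMap

/-- A `T`-space of `k[x]₀`: a `k`-linear subspace of `k[x]₀` closed under
substitutions `f ↦ f ∘ g` for `g ∈ k[x]₀`. -/
def IsTSpace (V : Submodule k (Polynomial k)) : Prop :=
  V ≤ A0 k ∧ ∀ f ∈ V, ∀ g ∈ A0 k, f.comp g ∈ V

/-- `H^S`: the smallest `T`-space of `k[x]₀` containing `H`. -/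
noncomputable def TSp (H : Set (Polynomial k)) : Submodule k (Polynomial k) :=
  sInf {V | IsTSpace k V ∧ H ⊆ V}

/-- A `T`-ideal of `k[x]₀`: a `T`-space that is also an ideal of `k[x]₀`. -/
def IsTIdeal (V : Submodule k (Polynomial k)) : Prop :=
  IsTSpace k V ∧ ∀ f ∈ V, ∀ g ∈ A0 k, g * f ∈ V

/-- `H^T`: the smallest `T`-ideal of `k[x]₀` containing `H`. -/
noncomputable def TId (H : Set (Polynomial k)) : Submodule k (Polynomial k) :=
  sInf {V | IsTIdeal k V ∧ H ⊆ V}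

/-- `W_n = {x + x^{q^n}}^S + {x^{q^n+1}}^S`, where `q` is the order of `k`. -/
noncomputable def Wn (n : ℕ) : Submodule k (Polynomial k) :=
  TSp k {X + X ^ (Fintype.card k ^ n)} ⊔ TSp k {X ^ (Fintype.card k ^ n + 1)}

/-- `U_n = {x - x^{q^{2n}}}^T`, where `q` is the order of `k`. -/
noncomputable def Un (n : ℕ) : Submodule k (Polynomial k) :=
  TId k {X - X ^ (Fintype.card k ^ (2 * n))}

section helpers

theorem hA0_mem (f : Polynomial k) : f ∈ A0 k ↔ f.coeff 0 = 0 := by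
  simp [A0, LinearMap.mem_ker, Polynomial.coeff_zero_eq_aeval_zero]

theorem hexpand (n : ℕ) (g : Polynomial k) :
    g ^ (Fintype.card k ^ n) = expand k (Fintype.card k ^ n) g := by
  induction n with
  | zero => simp
  | succ n ih =>
    rw [pow_succ, pow_mul, ih, ← FiniteField.expand_card, expand_expand, mul_comm]

theorem hQ (n : ℕ) (hn : 1 ≤ n) : 2 ≤ Fintype.card k ^ n := by
  have h1 : 1 < Fintype.card k := Fintype.one_lt_card
  exact Nat.one_lt_pow (by omega) h1

theorem hT_min (H : Set (Polynomial k)) (V : Submodule k (Polynomial k))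
    (hV : IsTSpace k V) (h : H ⊆ V) : TSp k H ≤ V := sInf_le ⟨hV, h⟩

theorem hT_comp (f g : Polynomial k) (hg : g ∈ A0 k) : f.comp g ∈ TSp k {f} := by
  rw [TSp, Submodule.mem_sInf]
  rintro V ⟨hV, h⟩
  exact hV.2 f (h rfl) g hg

theorem hA0_T : IsTSpace k (A0 k) := by
  refine ⟨le_rfl, fun f hf g hg => ?_⟩
  rw [hA0_mem] at *
  rw [coeff_zero_eq_eval_zero] at *
  rw [eval_comp, hg, hf]

/-- the weight of the exponent `m` -/
noncomputable def wt (Q c m : ℕ) : k :=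
  (if m ≡ c [MOD (Q ^ 2 - 1)] then 1 else 0) - (if Q * m ≡ c [MOD (Q ^ 2 - 1)] then 1 else 0)

/-- the separating functional -/
noncomputable def phi (Q c : ℕ) : Polynomial k →ₗ[k] k :=
  (Polynomial.basisMonomials k).constr k (wt k Q c)

theorem phi_monomial (Q c m : ℕ) (a : k) : phi k Q c (monomial m a) = a * wt k Q c m := by
  have h : phi k Q c (monomial m 1) = wt k Q c m := by
    have := (Polynomial.basisMonomials k).constr_basis k (wt k Q c) m
    simpa [phi] using this
  have h2 : (monomial m a : Polynomial k) = a • monomial m 1 := by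
    simp [smul_monomial]
  rw [h2, map_smul, h, smul_eq_mul]

theorem modQ (Q i j : ℕ) (hQ : 2 ≤ Q) : Q * (i + Q * j) ≡ j + Q * i [MOD (Q ^ 2 - 1)] := by
  obtain ⟨t, ht⟩ : ∃ t, Q ^ 2 = t + 1 := ⟨Q ^ 2 - 1, by
    have : 0 < Q ^ 2 := by positivity
    omega⟩
  have h1 : Q * (i + Q * j) = (j + Q * i) + (Q ^ 2 - 1) * j := by
    have : Q ^ 2 - 1 = t := by omega
    rw [this]
    have : Q * (i + Q * j) = Q * i + Q ^ 2 * j := by ring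
    rw [this, ht]; ring
  rw [h1]
  simp [Nat.ModEq]

theorem wt_swap (Q c i j : ℕ) (hQ : 2 ≤ Q) :
    wt k Q c (i + Q * j) + wt k Q c (j + Q * i) = 0 := by
  have h1 : (Q * (i + Q * j) ≡ c [MOD (Q ^ 2 - 1)]) ↔ (j + Q * i ≡ c [MOD (Q ^ 2 - 1)]) :=
    ⟨fun h => (modQ Q i j hQ).symm.trans h, fun h => (modQ Q i j hQ).trans h⟩
  have h2 : (Q * (j + Q * i) ≡ c [MOD (Q ^ 2 - 1)]) ↔ (i + Q * j ≡ c [MOD (Q ^ 2 - 1)]) :=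
    ⟨fun h => (modQ Q j i hQ).symm.trans h, fun h => (modQ Q j i hQ).trans h⟩
  simp only [wt, h1, h2]
  ring

theorem wt_diag (Q c i : ℕ) (hQ : 2 ≤ Q) : wt k Q c (i + Q * i) = 0 := by
  have h1 : (Q * (i + Q * i) ≡ c [MOD (Q ^ 2 - 1)]) ↔ (i + Q * i ≡ c [MOD (Q ^ 2 - 1)]) :=
    ⟨fun h => (modQ Q i i hQ).symm.trans h, fun h => (modQ Q i i hQ).trans h⟩
  simp only [wt, h1]
  ring

theorem digits_inj (Q i j a b : ℕ) (hi : i < Q) (ha : a < Q)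
    (h : i + Q * j = a + Q * b) : i = a ∧ j = b := by
  have h1 := congrArg (· % Q) h
  simp only [Nat.add_mul_mod_self_left, Nat.mod_eq_of_lt hi, Nat.mod_eq_of_lt ha] at h1
  subst h1
  refine ⟨rfl, ?_⟩
  have : Q * j = Q * b := by omega
  exact Nat.eq_of_mul_eq_mul_left (by omega) this

theorem digits_lt (Q i j : ℕ) (hi : i < Q) (hj : j < Q) (hij : i ≠ j) :
    i + Q * j < Q ^ 2 - 1 := by
  have : i + Q * j + 1 < Q ^ 2 := by
    rcases Nat.lt_or_ge (j + 1) Q with h | h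
    · have : Q * (j + 2) ≤ Q * Q := Nat.mul_le_mul_left Q h
      nlinarith
    · have : Q = j + 1 := by omega
      subst this
      nlinarith [show i + 1 ≤ j by omega]
  omega

theorem wt_Y (Q i j a b : ℕ) (hQ : 2 ≤ Q) (hji : j < i) (hi : i < Q) (hba : b < a) (ha : a < Q) :
    wt k Q (a + Q * b) (i + Q * j) = if i + Q * j = a + Q * b then 1 else 0 := by
  have e1 := digits_lt Q i j hi (by omega) (by omega)
  have e2 := digits_lt Q j i (by omega) (by omega) (by omega)
  have e3 := digits_lt Q a b ha (by omega) (by omega)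
  have h1 : (Q * (i + Q * j) ≡ a + Q * b [MOD (Q ^ 2 - 1)]) ↔ False := by
    refine ⟨fun h => ?_, False.elim⟩
    have h' := (modQ Q i j hQ).symm.trans h
    have h'' := Nat.ModEq.eq_of_lt_of_lt h' e2 e3
    have := digits_inj Q _ _ _ _ (by omega) ha h''
    omega
  have h2 : (i + Q * j ≡ a + Q * b [MOD (Q ^ 2 - 1)]) ↔ i + Q * j = a + Q * b :=
    ⟨fun h => Nat.ModEq.eq_of_lt_of_lt h e1 e3, fun h => by rw [h]⟩
  simp only [wt, h1, h2]
  simp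

theorem phi_anti (Q c : ℕ) (hQ : 2 ≤ Q) (f g : Polynomial k) :
    phi k Q c (f * expand k Q g) + phi k Q c (g * expand k Q f) = 0 := by
  induction f using Polynomial.induction_on' with
  | add p r hp hr =>
    simp only [map_add, add_mul, mul_add]
    linear_combination hp + hr
  | monomial i a =>
    induction g using Polynomial.induction_on' with
    | add p r hp hr =>
      simp only [map_add, add_mul, mul_add]
      linear_combination hp + hr
    | monomial j b =>
      simp only [expand_monomial, monomial_mul_monomial, phi_monomial]
      have := wt_swap k Q c i j hQ
      rw [mul_comm j Q, mul_comm i Q]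
      linear_combination (a * b) * this

theorem phi_alt (Q c : ℕ) (hQ : 2 ≤ Q) (f : Polynomial k) :
    phi k Q c (f * expand k Q f) = 0 := by
  induction f using Polynomial.induction_on' with
  | add p r hp hr =>
    have := phi_anti k Q c hQ p r
    simp only [map_add, add_mul, mul_add] at *
    linear_combination hp + hr + this
  | monomial i a =>
    simp only [expand_monomial, monomial_mul_monomial, phi_monomial]
    rw [mul_comm i Q, wt_diag k Q c i hQ, mul_zero]

/-- the largest `T`-space killed by the functional -/
noncomputable def Kc (Q c : ℕ) : Submodule k (Polynomial k) where
  carrier := {f | f ∈ A0 k ∧ ∀ g ∈ A0 k, phi k Q c (f.comp g) = 0}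
  zero_mem' := ⟨zero_mem _, by simp⟩
  add_mem' := by
    rintro f g ⟨hf, hf'⟩ ⟨hg, hg'⟩
    refine ⟨add_mem hf hg, fun h hh => ?_⟩
    rw [add_comp, map_add, hf' h hh, hg' h hh, add_zero]
  smul_mem' := by
    rintro a f ⟨hf, hf'⟩
    refine ⟨Submodule.smul_mem _ a hf, fun h hh => ?_⟩
    rw [smul_comp, map_smul, hf' h hh, smul_zero]

theorem Kc_T (Q c : ℕ) : IsTSpace k (Kc k Q c) := by
  refine ⟨fun f hf => hf.1, fun f hf g hg => ⟨(hA0_T k).2 f hf.1 g hg, fun h hh => ?_⟩⟩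
  rw [comp_assoc]
  exact hf.2 _ ((hA0_T k).2 g hg h hh)

theorem X_pow_A0 (m : ℕ) (hm : 1 ≤ m) : (X ^ m : Polynomial k) ∈ A0 k := by
  rw [hA0_mem, coeff_X_pow, if_neg (by omega)]

theorem Wn_le_Kc (n c : ℕ) (hn : 1 ≤ n) : Wn k n ≤ Kc k (Fintype.card k ^ n) c := by
  have hq := hQ k n hn
  refine sup_le (hT_min k _ _ (Kc_T k _ _) ?_) (hT_min k _ _ (Kc_T k _ _) ?_)
  · rw [Set.singleton_subset_iff]
    refine ⟨add_mem ?_ (X_pow_A0 k _ (by omega)), fun g hg => ?_⟩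
    · simpa using X_pow_A0 k 1 le_rfl
    · have := phi_anti k (Fintype.card k ^ n) c hq g 1
      simp only [map_one, mul_one, one_mul] at this
      rw [add_comp, X_comp, X_pow_comp, hexpand, map_add, this]
  · rw [Set.singleton_subset_iff]
    refine ⟨X_pow_A0 k _ (by omega), fun g hg => ?_⟩
    rw [X_pow_comp, pow_succ, hexpand, mul_comm]
    exact phi_alt k _ c hq g

theorem diag_mem (n i : ℕ) (hi : 1 ≤ i) :
    (X ^ (i + Fintype.card k ^ n * i) : Polynomial k) ∈ Wn k n := by
  refine Submodule.mem_sup_right ?_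
  have := hT_comp k (X ^ (Fintype.card k ^ n + 1)) (X ^ i) (X_pow_A0 k i hi)
  rw [X_pow_comp, ← pow_mul] at this
  convert this using 2
  ring

theorem swap_mem (n i j : ℕ) (hij : i < j) :
    (X ^ (i + Fintype.card k ^ n * j) + X ^ (j + Fintype.card k ^ n * i) : Polynomial k)
      ∈ Wn k n := by
  rcases Nat.eq_zero_or_pos i with rfl | hi
  · refine Submodule.mem_sup_left ?_
    have := hT_comp k (X + X ^ (Fintype.card k ^ n)) (X ^ j) (X_pow_A0 k j (by omega))
    rw [add_comp, X_comp, X_pow_comp, ← pow_mul, mul_comm j] at this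
    simpa [add_comm] using this
  · have h1 : ((X ^ i + X ^ j : Polynomial k)) ^ (Fintype.card k ^ n + 1) ∈ Wn k n := by
      refine Submodule.mem_sup_right ?_
      have := hT_comp k (X ^ (Fintype.card k ^ n + 1)) (X ^ i + X ^ j)
        (add_mem (X_pow_A0 k i hi) (X_pow_A0 k j (by omega)))
      rwa [X_pow_comp] at this
    have h2 := sub_mem (sub_mem h1 (diag_mem k n i hi)) (diag_mem k n j (by omega))
    convert h2 using 1
    rw [pow_succ, hexpand]
    simp only [map_add, map_pow, expand_X, ← pow_mul]
    ring

/-- the set of monomials spanning the complement -/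
def Yset (Q : ℕ) : Set (Polynomial k) :=
  {f : Polynomial k | ∃ i j : ℕ, j < i ∧ i < Q ∧ f = X ^ (i + Q * j)}

theorem sup_part (n : ℕ) (hn : 1 ≤ n) :
    Submodule.span k (Yset k (Fintype.card k ^ n)) ⊔ Wn k n = A0 k := by
  have hq := hQ k n hn
  apply le_antisymm
  · refine sup_le (Submodule.span_le.2 ?_) (fun f hf => (Wn_le_Kc k n 0 hn hf).1)
    rintro f ⟨i, j, h1, h2, rfl⟩
    exact X_pow_A0 k _ (by omega)
  · have key : ∀ m : ℕ, 1 ≤ m → (X ^ m : Polynomial k) ∈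
        Submodule.span k (Yset k (Fintype.card k ^ n)) ⊔ Wn k n := by
      intro m
      induction m using Nat.strong_induction_on with
      | _ m ih =>
        intro hm
        set Q := Fintype.card k ^ n with hQdef
        obtain ⟨i, j, hi, rfl⟩ : ∃ i j, i < Q ∧ m = i + Q * j :=
          ⟨m % Q, m / Q, Nat.mod_lt _ (by omega), (Nat.mod_add_div m Q).symm⟩
        rcases lt_trichotomy j i with h | h | h
        · exact Submodule.mem_sup_left (Submodule.subset_span ⟨i, j, h, hi, rfl⟩)
        · subst h
          refine Submodule.mem_sup_right (diag_mem k n j ?_)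
          rcases Nat.eq_zero_or_pos j with rfl | h
          · simp at hm
          · exact h
        · have hlt : j + Q * i < i + Q * j := by nlinarith
          have h1 := ih (j + Q * i) hlt (by omega)
          have h2 := Submodule.mem_sup_right (S := Submodule.span k (Yset k Q)) (swap_mem k n i j h)
          have := sub_mem h2 h1
          rwa [← hQdef, add_sub_cancel_right] at this
    intro f hf
    rw [hA0_mem] at hf
    rw [f.as_sum_support_C_mul_X_pow]
    refine Submodule.sum_mem _ fun m hm => ?_
    rw [← smul_eq_C_mul]
    refine Submodule.smul_mem _ _ (key m ?_)
    rcases Nat.eq_zero_or_pos m with rfl | h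
    · exact absurd hf (mem_support_iff.1 hm)
    · exact h

theorem phi_Y (Q a b : ℕ) (hQ : 2 ≤ Q) (hba : b < a) (ha : a < Q) (f : Polynomial k)
    (hf : f ∈ Submodule.span k (Yset k Q)) : phi k Q (a + Q * b) f = f.coeff (a + Q * b) := by
  induction hf using Submodule.span_induction with
  | mem f h =>
    obtain ⟨i, j, h1, h2, rfl⟩ := h
    rw [X_pow_eq_monomial, phi_monomial, wt_Y k Q i j a b hQ h1 h2 hba ha, coeff_monomial, one_mul]
  | zero => simp
  | add f g _ _ h1 h2 => rw [map_add, coeff_add, h1, h2]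
  | smul c f _ h => rw [map_smul, coeff_smul, h]

theorem coeff_Y (Q m : ℕ) (hm : ¬ ∃ a b, b < a ∧ a < Q ∧ m = a + Q * b) (f : Polynomial k)
    (hf : f ∈ Submodule.span k (Yset k Q)) : f.coeff m = 0 := by
  induction hf using Submodule.span_induction with
  | mem f h =>
    obtain ⟨i, j, h1, h2, rfl⟩ := h
    rw [coeff_X_pow, if_neg]
    exact fun h => hm ⟨i, j, h1, h2, h⟩
  | zero => simp
  | add f g _ _ h1 h2 => rw [coeff_add, h1, h2, add_zero]
  | smul c f _ h => rw [coeff_smul, h, smul_zero]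

theorem inf_part (n : ℕ) (hn : 1 ≤ n) :
    Submodule.span k (Yset k (Fintype.card k ^ n)) ⊓ Wn k n = ⊥ := by
  rw [eq_bot_iff]
  rintro f ⟨hY, hW⟩
  rw [Submodule.mem_bot]
  ext m
  rw [coeff_zero]
  by_cases hm : ∃ a b, b < a ∧ a < Fintype.card k ^ n ∧ m = a + Fintype.card k ^ n * b
  · obtain ⟨a, b, h1, h2, rfl⟩ := hm
    rw [← phi_Y k _ a b (hQ k n hn) h1 h2 f hY]
    have := (Wn_le_Kc k n (a + Fintype.card k ^ n * b) hn hW).2 X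
      (by simpa using X_pow_A0 k 1 le_rfl)
    rwa [comp_X] at this
  · exact coeff_Y k _ m hm f hY

theorem li_part (Q : ℕ) :
    LinearIndependent k (fun v : ↥(Yset k Q) => (v : Polynomial k)) := by
  have h := (Polynomial.basisMonomials k).linearIndependent.linearIndepOn_id
  have hsub : Yset k Q ⊆ Set.range (Polynomial.basisMonomials k) := by
    rintro f ⟨i, j, h1, h2, rfl⟩
    refine ⟨i + Q * j, ?_⟩
    rw [coe_basisMonomials, X_pow_eq_monomial]
  have h3 : LinearIndepOn k id (Yset k Q) := LinearIndepOn.mono h hsub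
  exact h3

theorem rank_part (Q : ℕ) :
    Module.finrank k ↥(Submodule.span k (Yset k Q)) = Q * (Q - 1) / 2 := by
  classical
  let F : Finset (Polynomial k) :=
    ((Finset.range Q).sigma (fun i => Finset.range i)).image
      (fun p : (Σ _ : ℕ, ℕ) => (X ^ (p.1 + Q * p.2) : Polynomial k))
  have hF : (F : Set (Polynomial k)) = Yset k Q := by
    ext f
    simp only [F, Yset, Finset.coe_image, Set.mem_image, Finset.mem_coe, Finset.mem_sigma,
      Finset.mem_range, Set.mem_ofPred_eq]
    constructor
    · rintro ⟨⟨i, j⟩, ⟨h1, h2⟩, rfl⟩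
      exact ⟨i, j, h2, h1, rfl⟩
    · rintro ⟨i, j, h2, h1, rfl⟩
      exact ⟨⟨i, j⟩, ⟨h1, h2⟩, rfl⟩
  have hli := li_part k Q
  rw [← hF] at hli ⊢
  have h3 : Module.finrank k ↥(Submodule.span k (F : Set (Polynomial k))) = F.card :=
    finrank_span_finset_eq_card hli
  rw [h3, Finset.card_image_of_injOn, Finset.card_sigma]
  · simp [Finset.sum_range_id]
  · rintro ⟨i, j⟩ h ⟨a, b⟩ h' heq
    simp only [Finset.coe_sigma, Set.mem_sigma_iff, Finset.mem_coe, Finset.mem_range] at h h'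
    have he : i + Q * j = a + Q * b := by
      have := congrArg natDegree heq
      simpa using this
    obtain ⟨rfl, rfl⟩ := digits_inj Q i j a b h.1 h'.1 he
    rfl

end helpers

/-- For each `n ≥ 1`, `k[x]₀ = Y_n ⊕ W_n`, where `Y_n` is the span of the set
`{x^{i + q^n j} : q^n > i > j ≥ 0}`; moreover that set is a `k`-linear basis of
`Y_n`, so `Y_n` has dimension `q^n (q^n - 1)/2`. -/
theorem Yn_compl_Wn (n : ℕ) (hn : 1 ≤ n) :
    Submodule.span k
        {f : Polynomial k | ∃ i j : ℕ, j < i ∧ i < Fintype.card k ^ n ∧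
          f = X ^ (i + Fintype.card k ^ n * j)} ⊔ Wn k n = A0 k ∧
    Submodule.span k
        {f : Polynomial k | ∃ i j : ℕ, j < i ∧ i < Fintype.card k ^ n ∧
          f = X ^ (i + Fintype.card k ^ n * j)} ⊓ Wn k n = ⊥ ∧
    LinearIndependent k
      (fun v : ↥{f : Polynomial k | ∃ i j : ℕ, j < i ∧ i < Fintype.card k ^ n ∧
          f = X ^ (i + Fintype.card k ^ n * j)} => (v : Polynomial k)) ∧
    Module.finrank k
        ↥(Submodule.span k
          {f : Polynomial k | ∃ i j : ℕ, j < i ∧ i < Fintype.card k ^ n ∧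
            f = X ^ (i + Fintype.card k ^ n * j)}) =
      Fintype.card k ^ n * (Fintype.card k ^ n - 1) / 2 := by
  exact ⟨sup_part k n hn, inf_part k n hn, li_part k _, rank_part k _⟩
end
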